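/- arXiv:2106.02013 — 3 statements merged into one kernel-verified Lean document; each statement's English description precedes it below -/
import Mathlib

section
/- For every even natural number d ≥ 2 there exists a d-regular measurably bipartite treeing T with vertex space (V, ν) that cannot be represented as the Schreier graphing of a pmp action of the free group F_{d/2}: there do not exist Borel measure-preserving bijections S₁, …, S_{d/2} : V → V generating an essentially free action of the free group F_{d/2} (i.e. for ν-almost every x, w·x ≠ x for every nontrivial reduced word w in S₁,…,S_{d/2}) such that for ν-almost every x the set of neighbors of x in T equals {S₁x, S₁⁻¹x, …, S_{d/2}x, S_{d/2}⁻¹x}. -/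
/-- A graphing: a standard Borel probability space `(V, ν)` together with a symmetric
irreflexive Borel edge set `E ⊆ V × V` with finite degrees satisfying the
mass-transport (measure-preservation) identity. -/
structure Graphing where
  V : Type
  [mV : MeasurableSpace V]
  [sb : StandardBorelSpace V]
  ν : MeasureTheory.Measure V
  [prob : MeasureTheory.IsProbabilityMeasure ν]
  E : Set (V × V)
  E_meas : MeasurableSet E
  symm : ∀ x y : V, (x, y) ∈ E → (y, x) ∈ E
  irrefl : ∀ x : V, (x, x) ∉ E
  locFin : ∀ x : V, {y : V | (x, y) ∈ E}.Finite
  massTransport : ∀ A B : Set V, MeasurableSet A → MeasurableSet B →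
    ∫ x in A, ((Set.ncard {y ∈ B | (x, y) ∈ E} : ℝ)) ∂ν
      = ∫ x in B, ((Set.ncard {y ∈ A | (x, y) ∈ E} : ℝ)) ∂ν

attribute [instance] Graphing.mV Graphing.sb Graphing.prob

open MeasureTheory

/-- The degree of a vertex. -/
noncomputable def Graphing.deg (G : Graphing) (x : G.V) : ℕ := {y : G.V | (x, y) ∈ G.E}.ncard

/-- `G` is `d`-regular. -/
def Graphing.IsRegular (G : Graphing) (d : ℕ) : Prop := ∀ x : G.V, G.deg x = d

/-- `G` is acyclic: there is no injective cyclic sequence `x₀, …, x_{k-1}` (`k ≥ 3`)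
of consecutively adjacent vertices (indices mod `k`). -/
def Graphing.Acyclic (G : Graphing) : Prop :=
  ¬ ∃ (k : ℕ) (x : Fin (k + 1) → G.V), 2 ≤ k ∧ Function.Injective x ∧
      ∀ i : Fin (k + 1), (x i, x (i + 1)) ∈ G.E

/-- `G` is measurably bipartite: a Borel set `A` meets every edge in exactly one endpoint. -/
def Graphing.MeasurablyBipartite (G : Graphing) : Prop :=
  ∃ A : Set G.V, MeasurableSet A ∧ ∀ x y : G.V, (x, y) ∈ G.E → (x ∈ A ↔ y ∉ A)

/-- A circulation: an antisymmetric Borel function supported on `E` whose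
sum over the neighbours of each vertex vanishes. -/
def Graphing.IsCirculation (G : Graphing) (f : G.V × G.V → ℝ) : Prop :=
  Measurable f ∧ (∀ x y : G.V, f (x, y) = - f (y, x)) ∧
    (∀ x y : G.V, (x, y) ∉ G.E → f (x, y) = 0) ∧
    ∀ x : G.V, ∑ᶠ y : G.V, f (x, y) = 0

/-- A measurable perfect matching: a symmetric Borel subset of `E` such that almost
every vertex has exactly one `M`-neighbour. -/
def Graphing.IsPerfectMatching (G : Graphing) (M : Set (G.V × G.V)) : Prop :=
  M ⊆ G.E ∧ MeasurableSet M ∧ (∀ x y : G.V, (x, y) ∈ M → (y, x) ∈ M) ∧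
    ∀ᵐ x ∂G.ν, ∃! y : G.V, (x, y) ∈ M



open MeasureTheory

namespace TreeConstr

variable (N : ℕ → ℕ)

/-- Sequence space. -/
abbrev XX : Type := ∀ n : ℕ, Fin (N n)

variable {N}

/-- agreement on the first n coordinates. -/
def Agree (n : ℕ) (x y : XX N) : Prop := ∀ k < n, x k = y k

theorem Agree.symm {n : ℕ} {x y : XX N} (h : Agree n x y) : Agree n y x :=
  fun k hk => (h k hk).symm

theorem Agree.trans {n : ℕ} {x y z : XX N} (h : Agree n x y) (h' : Agree n y z) : Agree n x z :=
  fun k hk => (h k hk).trans (h' k hk)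

theorem Agree.mono {n m : ℕ} {x y : XX N} (hmn : m ≤ n) (h : Agree n x y) : Agree m x y :=
  fun k hk => h k (hk.trans_le hmn)

theorem Agree.rfl' {n : ℕ} {x : XX N} : Agree n x x := fun _ _ => rfl

/-- replace the prefix. -/
def sw (k : ℕ) (a x : XX N) : XX N := fun j => if j < k then a j else x j

open Classical in
/-- elementary modification: a cycle moving coordinate `n` up over the cylinder of `a` and down
over the cylinder of `b`. -/
noncomputable def C (n k : ℕ) (a b x : XX N) : XX N :=
  if Agree k x a then
    (if h : (x n : ℕ) + 1 < N n then Function.update x n ⟨(x n : ℕ) + 1, h⟩ else sw k b x)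
  else if Agree k x b then
    (if 0 < (x n : ℕ) then
      Function.update x n ⟨(x n : ℕ) - 1, lt_of_le_of_lt (Nat.sub_le _ _) (x n).2⟩ else sw k a x)
  else x

theorem sw_agree (k : ℕ) (a x : XX N) : Agree k (sw k a x) a := fun j hj => by simp [sw, hj]

theorem update_agree {n k : ℕ} (hk : k ≤ n) (x : XX N) (v : Fin (N n)) :
    Agree k (Function.update x n v) x := fun j hj => by
  rw [Function.update_of_ne (by omega)]

theorem C_inv {n k : ℕ} {a b : XX N} (hk : k ≤ n) (hab : ¬ Agree k a b) (x : XX N) :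
    C n k b a (C n k a b x) = x := by
  by_cases h1 : Agree k x a
  · have h2 : ¬ Agree k x b := fun h => hab (h1.symm.trans h)
    by_cases h3 : (x n : ℕ) + 1 < N n
    · have e : C n k a b x = Function.update x n ⟨(x n : ℕ) + 1, h3⟩ := by simp [C, h1, h3]
      have h4 : ¬ Agree k (C n k a b x) b := fun h => h2 (by
        rw [e] at h; exact (update_agree hk _ _).symm.trans h)
      have h5 : Agree k (C n k a b x) a := by
        rw [e]; exact (update_agree hk _ _).trans h1
      rw [C, if_neg h4, if_pos h5, e]
      simp
    · have e : C n k a b x = sw k b x := by simp [C, h1, h3]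
      have h4 : Agree k (C n k a b x) b := by rw [e]; exact sw_agree _ _ _
      rw [C, if_pos h4, e]
      have : (sw k b x) n = x n := by simp [sw, hk]
      rw [dif_neg (by rw [this]; exact h3)]
      funext j
      simp only [sw]
      split_ifs with hj
      · exact (h1 j hj).symm
      · rfl
  · by_cases h2 : Agree k x b
    · by_cases h3 : 0 < (x n : ℕ)
      · have e : C n k a b x = Function.update x n
            ⟨(x n : ℕ) - 1, lt_of_le_of_lt (Nat.sub_le _ _) (x n).2⟩ := by simp [C, h1, h2, h3]
        have h4 : Agree k (C n k a b x) b := by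
          rw [e]; exact (update_agree hk _ _).trans h2
        rw [C, if_pos h4, e]
        have := (x n).2
        rw [dif_pos (by simp only [Function.update_self]; omega)]
        funext j
        by_cases hj : j = n
        · subst hj
          simp only [Function.update_self]
          ext; simp; omega
        · simp [Function.update_of_ne hj]
      · have e : C n k a b x = sw k a x := by simp [C, h1, h2, h3]
        have h5 : Agree k (C n k a b x) a := by rw [e]; exact sw_agree _ _ _
        have h4 : ¬ Agree k (C n k a b x) b := fun h => hab (h5.symm.trans h)
        rw [C, if_neg h4, if_pos h5, e]
        have : (sw k a x) n = x n := by simp [sw, hk]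
        rw [if_neg (by rw [this]; exact h3)]
        funext j
        simp only [sw]
        split_ifs with hj
        · exact (h2 j hj).symm
        · rfl
    · have e : C n k a b x = x := by simp [C, h1, h2]
      rw [e]; simp [C, h1, h2]

theorem C_of_gt {n k : ℕ} {a b : XX N} (hk : k ≤ n) (x : XX N) {j : ℕ} (hj : n < j) :
    C n k a b x j = x j := by
  have h1 : j ≠ n := by omega
  have h2 : ¬ j < k := by omega
  unfold C
  split_ifs <;> simp [sw, h1, h2]

theorem C_agree {n k m : ℕ} {a b : XX N} (hk : k ≤ n) (hm : n < m) {x y : XX N}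
    (h : Agree m x y) : Agree m (C n k a b x) (C n k a b y) := by
  have hn : x n = y n := h n hm
  have ha : ∀ c : XX N, Agree k x c ↔ Agree k y c := fun c =>
    ⟨fun h' => (h.mono (by omega)).symm.trans h', fun h' => (h.mono (by omega)).trans h'⟩
  intro j hj
  have hxy := h j hj
  by_cases h1 : Agree k x a
  · have h1' := (ha a).1 h1
    by_cases hjn : j = n
    · subst hjn
      simp only [C, h1, h1', hn, if_true]
      split_ifs <;> simp [sw, hxy]
    · simp only [C, h1, h1', hn, if_true]
      split_ifs <;> simp [sw, hxy, hjn]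
  · have h1' : ¬ Agree k y a := fun h' => h1 ((ha a).2 h')
    by_cases h2 : Agree k x b
    · have h2' := (ha b).1 h2
      by_cases hjn : j = n
      · subst hjn
        simp only [C, h1, h1', h2, h2', hn, if_true, if_false]
        split_ifs <;> simp [sw, hxy]
      · simp only [C, h1, h1', h2, h2', hn, if_true, if_false]
        split_ifs <;> simp [sw, hxy, hjn]
    · have h2' : ¬ Agree k y b := fun h' => h2 ((ha b).2 h')
      simp only [C, h1, h1', h2, h2', if_false, hxy]

theorem C_near {n k : ℕ} {a b : XX N} (hk : k ≤ n) (x : XX N) :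
    (C n k a b x n : ℕ) ≤ x n + 1 ∧ (x n : ℕ) ≤ C n k a b x n + 1 := by
  have h2 : ¬ n < k := by omega
  unfold C
  split_ifs <;> simp [sw, h2] <;> omega

theorem C_good {n k : ℕ} {a b : XX N} (x : XX N)
    (h0 : 0 < (x n : ℕ)) (h1 : (x n : ℕ) + 1 < N n) : Agree n (C n k a b x) x := by
  unfold C
  split_ifs
  · exact update_agree le_rfl _ _
  · exact update_agree le_rfl _ _
  · exact Agree.rfl'

open Classical in
theorem C_diff {n k : ℕ} {a b : XX N} (hab : ¬ Agree k a b) (x : XX N)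
    (h0 : 0 < (x n : ℕ)) (h1 : (x n : ℕ) + 1 < N n) :
    ((C n k a b x n : ℕ) : ℤ) - (x n : ℕ) =
      (if Agree k x a then 1 else 0) - (if Agree k x b then 1 else 0) := by
  by_cases ha : Agree k x a
  · have hb : ¬ Agree k x b := fun h => hab (ha.symm.trans h)
    simp [C, ha, hb, h1]
  · by_cases hb : Agree k x b
    · simp [C, ha, hb, h0]
    · simp [C, ha, hb]

/-! A schedule of modifications. -/

/-- schedule data -/
structure Sched (N : ℕ → ℕ) where
  k : ℕ → ℕ
  a : ℕ → XX N
  b : ℕ → XX N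
  freq : ∀ (j : ℕ) (x y : XX N) (M : ℕ), ∃ n, M ≤ n ∧ k n = j ∧ Agree j (a n) x ∧ Agree j (b n) y

theorem exists_sched (hN : ∀ n, 2 ≤ N n) : Nonempty (Sched N) := by
  let Q := Σ k : ℕ, (∀ i : Fin k, Fin (N i)) × (∀ i : Fin k, Fin (N i))
  have : Nonempty (Q × ℕ) := ⟨⟨⟨0, ⟨fun i => i.elim0, fun i => i.elim0⟩⟩, 0⟩⟩
  obtain ⟨s, hs⟩ := exists_surjective_nat (Q × ℕ)
  let ex : (k : ℕ) → (∀ i : Fin k, Fin (N i)) → XX N := fun k p j =>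
    if h : j < k then p ⟨j, h⟩ else ⟨0, by have := hN j; omega⟩
  refine ⟨⟨fun n => (s n).1.1, fun n => ex _ (s n).1.2.1, fun n => ex _ (s n).1.2.2, ?_⟩⟩
  intro j x y M
  let q : Q := ⟨j, fun i => x i, fun i => y i⟩
  have hinf : (s ⁻¹' (Set.range fun i : ℕ => (q, i))).Infinite := by
    apply Set.Infinite.preimage
    · exact Set.infinite_range_of_injective (fun a b h => by simpa using h)
    · intro z _; exact hs z
  obtain ⟨n, ⟨i, hi⟩, hn⟩ := hinf.exists_gt M
  refine ⟨n, hn.le, ?_⟩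
  have hq : (s n).1 = q := by rw [← hi]
  rw [hq]
  refine ⟨rfl, fun i hi => ?_, fun i hi => ?_⟩ <;> simp [ex, q, hi]

variable (S : Sched N)

namespace Sched

/-- validity of step n -/
def Valid (n : ℕ) : Prop := 1 ≤ n ∧ S.k n ≤ n ∧ ¬ Agree (S.k n) (S.a n) (S.b n)

open Classical in
/-- the n-th modification -/
noncomputable def c (n : ℕ) : Equiv.Perm (XX N) :=
  if h : S.Valid n then
    ⟨C n (S.k n) (S.a n) (S.b n), C n (S.k n) (S.b n) (S.a n),
      C_inv h.2.1 h.2.2, C_inv h.2.1 (fun h' => h.2.2 h'.symm)⟩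
  else 1

theorem c_of_gt (n : ℕ) (x : XX N) {j : ℕ} (hj : n < j) : S.c n x j = x j := by
  unfold c; split_ifs with h
  · exact C_of_gt h.2.1 x hj
  · rfl

theorem ci_of_gt (n : ℕ) (x : XX N) {j : ℕ} (hj : n < j) : (S.c n)⁻¹ x j = x j := by
  unfold c; split_ifs with h
  · exact C_of_gt h.2.1 x hj
  · rfl

theorem c_agree {n m : ℕ} (hm : n < m) {x y : XX N} (hxy : Agree m x y) :
    Agree m (S.c n x) (S.c n y) := by
  unfold c; split_ifs with h
  · exact C_agree h.2.1 hm hxy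
  · exact hxy

theorem ci_agree {n m : ℕ} (hm : n < m) {x y : XX N} (hxy : Agree m x y) :
    Agree m ((S.c n)⁻¹ x) ((S.c n)⁻¹ y) := by
  unfold c; split_ifs with h
  · exact C_agree h.2.1 hm hxy
  · exact hxy

theorem c_near (n : ℕ) (x : XX N) :
    (S.c n x n : ℕ) ≤ x n + 1 ∧ (x n : ℕ) ≤ S.c n x n + 1 := by
  unfold c; split_ifs with h
  · exact C_near h.2.1 x
  · simp

theorem ci_near (n : ℕ) (x : XX N) :
    ((S.c n)⁻¹ x n : ℕ) ≤ x n + 1 ∧ (x n : ℕ) ≤ (S.c n)⁻¹ x n + 1 := by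
  unfold c; split_ifs with h
  · exact C_near h.2.1 x
  · simp

theorem c_good {n : ℕ} {x : XX N} (h0 : 0 < (x n : ℕ)) (h1 : (x n : ℕ) + 1 < N n) :
    Agree n (S.c n x) x := by
  unfold c; split_ifs with h
  · exact C_good x h0 h1
  · exact Agree.rfl'

theorem ci_good {n : ℕ} {x : XX N} (h0 : 0 < (x n : ℕ)) (h1 : (x n : ℕ) + 1 < N n) :
    Agree n ((S.c n)⁻¹ x) x := by
  unfold c; split_ifs with h
  · exact C_good x h0 h1
  · exact Agree.rfl'

open Classical in
theorem c_diff {n : ℕ} (h : S.Valid n) {x : XX N} (h0 : 0 < (x n : ℕ)) (h1 : (x n : ℕ) + 1 < N n) :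
    ((S.c n x n : ℕ) : ℤ) - (x n : ℕ) =
      (if Agree (S.k n) x (S.a n) then 1 else 0) - (if Agree (S.k n) x (S.b n) then 1 else 0) := by
  have : S.c n x = C n (S.k n) (S.a n) (S.b n) x := by unfold c; rw [dif_pos h]; rfl
  rw [this]
  exact C_diff h.2.2 x h0 h1

/-- partial products -/
noncomputable def Th : ℕ → Equiv.Perm (XX N)
  | 0 => 1
  | n + 1 => Th n * S.c n

theorem Th_succ (n : ℕ) (x : XX N) : S.Th (n + 1) x = S.Th n (S.c n x) := rfl

theorem Thi_succ (n : ℕ) (x : XX N) : (S.Th (n + 1))⁻¹ x = (S.c n)⁻¹ ((S.Th n)⁻¹ x) := by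
  simp [Th, mul_inv_rev]

theorem Th_of_ge (n : ℕ) (x : XX N) {j : ℕ} (hj : n ≤ j) : S.Th n x j = x j := by
  induction n generalizing x with
  | zero => rfl
  | succ n ih => rw [Th_succ, ih _ (by omega), c_of_gt _ _ _ (by omega)]

theorem Thi_of_ge (n : ℕ) (x : XX N) {j : ℕ} (hj : n ≤ j) : (S.Th n)⁻¹ x j = x j := by
  induction n generalizing x with
  | zero => rfl
  | succ n ih => rw [Thi_succ, ci_of_gt _ _ _ (by omega), ih _ (by omega)]

theorem Th_agree {n m : ℕ} (hm : n ≤ m) {x y : XX N} (hxy : Agree m x y) :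
    Agree m (S.Th n x) (S.Th n y) := by
  induction n generalizing x y with
  | zero => exact hxy
  | succ n ih => rw [Th_succ, Th_succ]; exact ih (by omega) (S.c_agree (by omega) hxy)

theorem Thi_agree {n m : ℕ} (hm : n ≤ m) {x y : XX N} (hxy : Agree m x y) :
    Agree m ((S.Th n)⁻¹ x) ((S.Th n)⁻¹ y) := by
  induction n generalizing x y with
  | zero => exact hxy
  | succ n ih => rw [Thi_succ, Thi_succ]; exact S.ci_agree (by omega) (ih (by omega) hxy)

end Sched

/-- no end-point at coordinates at least n -/
def RR (n : ℕ) (x : XX N) : Prop := ∀ m, n ≤ m → 0 < (x m : ℕ) ∧ (x m : ℕ) + 1 < N m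

theorem RR.mono {n m : ℕ} (h : n ≤ m) {x : XX N} (hx : RR n x) : RR m x :=
  fun j hj => hx j (h.trans hj)

/-- the good set -/
def Good (x : XX N) : Prop := ∀ K : ℕ, ∃ n, ∀ m, n ≤ m → K ≤ (x m : ℕ) ∧ (x m : ℕ) + K < N m

theorem Good.rr {x : XX N} (h : Good x) : ∃ n, RR n x := by
  obtain ⟨n, hn⟩ := h 2
  exact ⟨n, fun m hm => by have := hn m hm; omega⟩

theorem Good.of_near {x y : XX N} (h : Good x) (n : ℕ)
    (hxy : ∀ m, n ≤ m → (y m : ℕ) ≤ x m + 1 ∧ (x m : ℕ) ≤ y m + 1) : Good y := by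
  intro K
  obtain ⟨n', hn⟩ := h (K + 1)
  refine ⟨max n n', fun m hm => ?_⟩
  have h1 := hn m (le_trans (le_max_right _ _) hm)
  have h2 := hxy m (le_trans (le_max_left _ _) hm)
  omega

namespace Sched

theorem Th_stab {n n1 n2 : ℕ} {x : XX N} (hx : RR n x) (h1 : n ≤ n1) (h2 : n1 ≤ n2) :
    Agree n1 (S.Th n2 x) (S.Th n1 x) := by
  induction n2, h2 using Nat.le_induction with
  | base => exact Agree.rfl'
  | succ m hm ih =>
    refine Agree.trans ?_ ih
    have := hx m (by omega)
    rw [Th_succ]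
    exact (S.Th_agree le_rfl (S.c_good this.1 this.2)).mono hm

theorem Thi_stab {n n1 n2 : ℕ} {x : XX N} (hx : RR n x) (h1 : n ≤ n1) (h2 : n1 ≤ n2) :
    Agree n1 ((S.Th n2)⁻¹ x) ((S.Th n1)⁻¹ x) := by
  induction n2, h2 using Nat.le_induction with
  | base => exact Agree.rfl'
  | succ m hm ih =>
    refine Agree.trans ?_ ih
    have := hx m (by omega)
    rw [Thi_succ]
    refine (S.ci_good ?_ ?_).mono hm <;> rw [S.Thi_of_ge _ _ le_rfl]
    exacts [this.1, this.2]

end Sched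

open Classical in
/-- first good index -/
noncomputable def idx (x : XX N) : ℕ := sInf {n | RR n x}

theorem idx_spec {x : XX N} (h : Good x) : RR (idx x) x := Nat.sInf_mem (s := {n | RR n x}) h.rr

theorem idx_le {n : ℕ} {x : XX N} (h : RR n x) : idx x ≤ n := Nat.sInf_le h

/-- limit of a stabilizing sequence -/
noncomputable def Lim (A : ℕ → XX N → XX N) (x : XX N) : XX N :=
  fun k => A (max (idx x) (k + 1)) x k

theorem Lim_agree {A : ℕ → XX N → XX N}
    (hA : ∀ (n n1 n2 : ℕ) (x : XX N), RR n x → n ≤ n1 → n1 ≤ n2 → Agree n1 (A n2 x) (A n1 x))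
    {x : XX N} (hg : Good x) {n : ℕ} (hx : RR n x) : Agree n (Lim A x) (A n x) := by
  intro k hk
  exact (hA (idx x) (max (idx x) (k + 1)) n x (idx_spec hg) (le_max_left _ _)
    (max_le (idx_le hx) hk) k (by omega)).symm

theorem eq_of_agree {x y : XX N} (M : ℕ) (h : ∀ n, M ≤ n → Agree n x y) : x = y := by
  funext k
  exact h (max M (k + 1)) (le_max_left _ _) k (by omega)

namespace Sched

theorem Lim_Th {x : XX N} (hg : Good x) {n : ℕ} (hx : RR n x) :
    Agree n (Lim (fun n x => S.Th n x) x) (S.Th n x) :=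
  Lim_agree (A := fun n x => S.Th n x) (fun _ _ _ _ h h1 h2 => S.Th_stab h h1 h2) hg hx

theorem Lim_Thi {x : XX N} (hg : Good x) {n : ℕ} (hx : RR n x) :
    Agree n (Lim (fun n x => (S.Th n)⁻¹ x) x) ((S.Th n)⁻¹ x) :=
  Lim_agree (A := fun n x => (S.Th n)⁻¹ x) (fun _ _ _ _ h h1 h2 => S.Thi_stab h h1 h2) hg hx

theorem Lim_Th_apply {x : XX N} (hg : Good x) {n : ℕ} (hx : RR (n + 1) x) :
    Lim (fun n x => S.Th n x) x n = S.c n x n := by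
  rw [S.Lim_Th hg hx n (by omega), Th_succ, Th_of_ge _ _ _ le_rfl]

theorem good_Th {x : XX N} (hg : Good x) : Good (Lim (fun n x => S.Th n x) x) := by
  obtain ⟨n, hn⟩ := hg.rr
  refine hg.of_near n fun m hm => ?_
  rw [S.Lim_Th_apply hg (hn.mono (by omega))]
  exact S.c_near m x

theorem good_Thi {x : XX N} (hg : Good x) : Good (Lim (fun n x => (S.Th n)⁻¹ x) x) := by
  obtain ⟨n, hn⟩ := hg.rr
  refine hg.of_near n fun m hm => ?_
  rw [S.Lim_Thi hg (hn.mono (show n ≤ m + 1 by omega)) m (by omega), Thi_succ]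
  have := S.ci_near m ((S.Th m)⁻¹ x)
  rwa [S.Thi_of_ge m x le_rfl] at this

/-- the limiting bijection of the good set -/
noncomputable def theta : Equiv.Perm {x : XX N // Good x} where
  toFun x := ⟨Lim (fun n x => S.Th n x) x.1, S.good_Th x.2⟩
  invFun x := ⟨Lim (fun n x => (S.Th n)⁻¹ x) x.1, S.good_Thi x.2⟩
  left_inv x := by
    apply Subtype.ext
    obtain ⟨n, hn⟩ := x.2.rr
    obtain ⟨n', hn'⟩ := (S.good_Th x.2).rr
    refine eq_of_agree (max n n') fun m hm => ?_
    refine (S.Lim_Thi (S.good_Th x.2) (hn'.mono (le_trans (le_max_right _ _) hm))).trans ?_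
    refine (S.Thi_agree le_rfl (S.Lim_Th x.2 (hn.mono (le_trans (le_max_left _ _) hm)))).trans ?_
    simp [Agree.rfl']
  right_inv x := by
    apply Subtype.ext
    obtain ⟨n, hn⟩ := x.2.rr
    obtain ⟨n', hn'⟩ := (S.good_Thi x.2).rr
    refine eq_of_agree (max n n') fun m hm => ?_
    refine (S.Lim_Th (S.good_Thi x.2) (hn'.mono (le_trans (le_max_right _ _) hm))).trans ?_
    refine (S.Th_agree le_rfl (S.Lim_Thi x.2 (hn.mono (le_trans (le_max_left _ _) hm)))).trans ?_
    simp [Agree.rfl']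

theorem theta_val (x : {x : XX N // Good x}) :
    (S.theta x).1 = Lim (fun n x => S.Th n x) x.1 := rfl

theorem theta_symm_val (x : {x : XX N // Good x}) :
    (S.theta.symm x).1 = Lim (fun n x => (S.Th n)⁻¹ x) x.1 := rfl

end Sched

end TreeConstr

open MeasureTheory

namespace TreeConstr

variable {N : ℕ → ℕ}

/-- restriction to a prefix -/
def pre (m : ℕ) (x : XX N) : ∀ i : Fin m, Fin (N i) := fun i => x i

theorem pre_eq_iff {m : ℕ} {x y : XX N} : pre m x = pre m y ↔ Agree m x y :=
  ⟨fun h k hk => congrFun h ⟨k, hk⟩, fun h => funext fun i => h i i.2⟩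

theorem sat_meas' (M : MeasurableSpace (XX N)) {m : ℕ}
    (hM : ∀ a : XX N, MeasurableSet[M] {x | Agree m x a}) {s : Set (XX N)}
    (h : ∀ x y, Agree m x y → x ∈ s → y ∈ s) : MeasurableSet[M] s := by
  have : s = ⋃ p ∈ (pre m '' s), {x | pre m x = p} := by
    ext x
    simp only [Set.mem_iUnion, Set.mem_image, Set.mem_ofPred_eq, exists_prop, exists_exists_and_eq_and]
    constructor
    · intro hx; exact ⟨x, hx, rfl⟩
    · rintro ⟨a, ha, hxa⟩; exact h a x (pre_eq_iff.1 hxa).symm ha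
  rw [this]
  refine MeasurableSet.biUnion (Set.to_countable _) ?_
  rintro p ⟨a, _, rfl⟩
  simpa [pre_eq_iff] using hM a

theorem cyl_meas (m : ℕ) (a : XX N) : MeasurableSet {x : XX N | Agree m x a} := by
  have : {x : XX N | Agree m x a} = ⋂ k, ⋂ (_ : k < m), {x | x k = a k} := by
    ext x; simp [Agree]
  rw [this]
  refine MeasurableSet.iInter fun k => MeasurableSet.iInter fun _ => ?_
  exact measurableSet_eq_fun (measurable_pi_apply k) measurable_const

theorem sat_meas {m : ℕ} {s : Set (XX N)} (h : ∀ x y, Agree m x y → x ∈ s → y ∈ s) :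
    MeasurableSet s := sat_meas' _ (cyl_meas m) h

/-- cylinders of depth at least n0 -/
def Cyl (n0 : ℕ) : Set (Set (XX N)) := {s | ∃ n, n0 ≤ n ∧ ∃ a, s = {x | Agree n x a}}

theorem cyl_gen (n0 : ℕ) :
    (MeasurableSpace.pi : MeasurableSpace (XX N)) = MeasurableSpace.generateFrom (Cyl n0) := by
  apply le_antisymm
  · refine iSup_le fun k => ?_
    rw [← measurable_iff_comap_le]
    refine @measurable_to_countable' _ _ _ _ (MeasurableSpace.generateFrom (Cyl n0)) _ fun t => ?_
    refine sat_meas' _ (m := max n0 (k + 1)) (fun a => ?_) ?_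
    · exact MeasurableSpace.measurableSet_generateFrom ⟨_, le_max_left _ _, a, rfl⟩
    · intro x y hxy hx
      have := hxy k (by omega)
      simp only [Set.mem_preimage, Set.mem_singleton_iff] at hx ⊢
      rw [← this, hx]
  · refine MeasurableSpace.generateFrom_le ?_
    rintro _ ⟨n, _, a, rfl⟩
    exact cyl_meas n a

theorem cyl_pi (n0 : ℕ) : IsPiSystem (Cyl (N := N) n0) := by
  rintro _ ⟨n, hn, a, rfl⟩ _ ⟨m, hm, b, rfl⟩ ⟨z, hz1, hz2⟩
  refine ⟨max n m, hn.trans (le_max_left _ _), z, ?_⟩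
  ext x
  simp only [Set.mem_inter_iff, Set.mem_ofPred_eq] at *
  constructor
  · rintro ⟨h1, h2⟩ k hk
    rcases lt_max_iff.1 hk with h | h
    · exact (h1 k h).trans (hz1 k h).symm
    · exact (h2 k h).trans (hz2 k h).symm
  · intro h
    exact ⟨(h.mono (le_max_left _ _)).trans hz1, (h.mono (le_max_right _ _)).trans hz2⟩

variable [∀ n, NeZero (N n)]

variable (N) in
/-- product of the uniform measures -/
noncomputable def mu : Measure (XX N) :=
  Measure.infinitePi (fun n => ProbabilityTheory.uniformOn (Set.univ : Set (Fin (N n))))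

instance : IsProbabilityMeasure (mu N) := by unfold mu; infer_instance

theorem mu_cyl (n : ℕ) (a : XX N) :
    mu N {x | Agree n x a} = ∏ k ∈ Finset.range n, (1 / (N k : ENNReal)) := by
  have : {x : XX N | Agree n x a} = Set.pi (Finset.range n : Set ℕ) (fun k => {a k}) := by
    ext x; simp [Agree, Set.mem_pi]
  rw [this, mu, Measure.infinitePi_pi _ (fun i _ => MeasurableSet.singleton _)]
  refine Finset.prod_congr rfl fun k _ => ?_
  rw [ProbabilityTheory.uniformOn_univ]
  simp

theorem mu_coord (n : ℕ) (s : Set (Fin (N n))) (K : ℕ) (hs : s.ncard ≤ K) :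
    mu N {x | x n ∈ s} ≤ K / (N n : ENNReal) := by
  have : {x : XX N | x n ∈ s} = Set.pi (({n} : Finset ℕ) : Set ℕ)
      (fun k => {t | ∀ h : k = n, h ▸ t ∈ s}) := by
    ext x; simp [Set.mem_pi]
  rw [this, mu, Measure.infinitePi_pi _ (fun i _ => (Set.toFinite _).measurableSet)]
  simp only [Finset.prod_singleton, forall_true_left]
  rw [ProbabilityTheory.uniformOn_univ]
  have h2 : Measure.count s ≤ (K : ENNReal) := by
    rw [Measure.count_apply_finite _ (Set.toFinite s)]
    rw [← Set.ncard_eq_toFinset_card]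
    exact_mod_cast hs
  simp only [Fintype.card_fin]
  gcongr
  exact h2

theorem mu_far (n K : ℕ) :
    mu N {x | ¬ (K ≤ (x n : ℕ) ∧ (x n : ℕ) + K < N n)} ≤ (2 * K : ℕ) / (N n : ENNReal) := by
  refine mu_coord n {t | ¬ (K ≤ (t : ℕ) ∧ (t : ℕ) + K < N n)} (2 * K) ?_
  have h1 : {t : Fin (N n) | (t : ℕ) < K}.ncard ≤ K := by
    have := Set.ncard_le_ncard_of_injOn (s := {t : Fin (N n) | (t : ℕ) < K})
      (t := (Finset.range K : Set ℕ)) (fun t => (t : ℕ)) (fun t ht => by simpa using ht)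
      (fun a _ b _ h => Fin.ext h)
    rwa [Set.ncard_coe_finset, Finset.card_range] at this
  have h2 : {t : Fin (N n) | N n ≤ (t : ℕ) + K}.ncard ≤ K := by
    have := Set.ncard_le_ncard_of_injOn (s := {t : Fin (N n) | N n ≤ (t : ℕ) + K})
      (t := (Finset.range K : Set ℕ)) (fun t => N n - 1 - (t : ℕ)) (fun t ht => by
        have := t.2
        simp only [Set.mem_ofPred_eq, Finset.coe_range, Set.mem_Iio] at ht ⊢; omega)
      (fun a _ b _ h => Fin.ext (by have := a.2; have := b.2; simp only at h; omega))
    rwa [Set.ncard_coe_finset, Finset.card_range] at this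
  have h3 : {t : Fin (N n) | ¬ (K ≤ (t : ℕ) ∧ (t : ℕ) + K < N n)} ⊆
      {t : Fin (N n) | (t : ℕ) < K} ∪ {t : Fin (N n) | N n ≤ (t : ℕ) + K} := by
    intro t ht
    simp only [Set.mem_ofPred_eq, Set.mem_union] at *
    omega
  calc _ ≤ _ := Set.ncard_le_ncard h3
    _ ≤ _ := Set.ncard_union_le _ _
    _ ≤ _ := by omega

/-- growth hypotheses -/
structure Hyp (N : ℕ → ℕ) : Prop where
  h2 : ∀ n, 2 ≤ N n
  hg : ∀ n m, 1 ≤ n → n < m → N n * 2 ^ (n + m) ≤ N m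

theorem Hyp.two_pow (H : Hyp N) {n : ℕ} (hn : 1 ≤ n) : 2 ^ n ≤ N n := by
  rcases hn.eq_or_lt with rfl | h
  · exact H.h2 1
  · have := H.hg 1 n le_rfl h
    have h1 := H.h2 1
    calc 2 ^ n ≤ 2 ^ (1 + n) := Nat.pow_le_pow_right (by norm_num) (by omega)
      _ ≤ N 1 * 2 ^ (1 + n) := Nat.le_mul_of_pos_left _ (by omega)
      _ ≤ _ := this

theorem Hyp.inv_le (H : Hyp N) (n : ℕ) : 1 / (N n : ENNReal) ≤ (2⁻¹) ^ n := by
  rcases Nat.eq_zero_or_pos n with rfl | hn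
  · have := H.h2 0
    simp only [pow_zero]
    rw [one_div, ENNReal.inv_le_one]
    exact_mod_cast (by omega : 1 ≤ N 0)
  · rw [one_div, ← ENNReal.inv_pow, ENNReal.inv_le_inv]
    exact_mod_cast H.two_pow hn

theorem good_meas : MeasurableSet {x : XX N | Good x} := by
  have : {x : XX N | Good x} = ⋂ K : ℕ, ⋃ n : ℕ, ⋂ m : ℕ, ⋂ (_ : n ≤ m),
      {x | K ≤ (x m : ℕ) ∧ (x m : ℕ) + K < N m} := by
    ext x; simp [Good]
  rw [this]
  refine MeasurableSet.iInter fun K => MeasurableSet.iUnion fun n => MeasurableSet.iInter fun m =>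
    MeasurableSet.iInter fun _ => sat_meas (m := m + 1) fun x y h hx => ?_
  simp only [Set.mem_ofPred_eq] at *
  rwa [← h m (by omega)]

theorem rr_meas (n : ℕ) : MeasurableSet {x : XX N | RR n x} := by
  have : {x : XX N | RR n x} = ⋂ m : ℕ, ⋂ (_ : n ≤ m),
      {x | 0 < (x m : ℕ) ∧ (x m : ℕ) + 1 < N m} := by
    ext x; simp [RR]
  rw [this]
  refine MeasurableSet.iInter fun m =>
    MeasurableSet.iInter fun _ => sat_meas (m := m + 1) fun x y h hx => ?_
  simp only [Set.mem_ofPred_eq] at *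
  rwa [← h m (by omega)]

theorem good_ae (H : Hyp N) : ∀ᵐ x ∂(mu N), Good x := by
  unfold Good
  rw [ae_all_iff]
  intro K
  have := ae_eventually_notMem (μ := mu N)
    (s := fun m => {x | ¬ (K ≤ (x m : ℕ) ∧ (x m : ℕ) + K < N m)}) ?_
  · filter_upwards [this] with x hx
    obtain ⟨n, hn⟩ := Filter.eventually_atTop.1 hx
    exact ⟨n, fun m hm => by simpa using hn m hm⟩
  · refine ne_top_of_le_ne_top ?_ (ENNReal.tsum_le_tsum (fun m => (mu_far m K).trans
      (?_ : _ ≤ (2 * K : ℕ) * (2⁻¹ : ENNReal) ^ m)))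
    · rw [ENNReal.tsum_mul_left, ENNReal.tsum_geometric]
      refine ENNReal.mul_ne_top (ENNReal.natCast_ne_top _) ?_
      simp
    · rw [← mul_one_div]
      gcongr
      exact H.inv_le m

theorem mu_end (H : Hyp N) (n : ℕ) :
    (mu N).real {x | ¬ (0 < (x n : ℕ) ∧ (x n : ℕ) + 1 < N n)} ≤ 2 * (1 / 2) ^ n := by
  have := mu_far (N := N) n 1
  have h : mu N {x | ¬ (0 < (x n : ℕ) ∧ (x n : ℕ) + 1 < N n)} ≤ 2 * (2⁻¹) ^ n := by
    refine this.trans ?_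
    rw [← mul_one_div]
    have := H.inv_le n
    norm_num at this ⊢
    gcongr
  have h2 := ENNReal.toReal_mono (by
    refine ENNReal.mul_ne_top (by simp) (ENNReal.pow_ne_top (by simp))) h
  simpa [Measure.real] using h2

theorem mu_tail (H : Hyp N) {n : ℕ} (hn : 1 ≤ n) :
    (N n : ℝ) * (mu N).real {x | ¬ RR (n + 1) x} ≤ 4 * (1 / 2) ^ n := by
  have h0 : (N n : ENNReal) ≠ 0 := by
    have := H.h2 n
    exact_mod_cast (by omega : N n ≠ 0)
  have hsub : {x : XX N | ¬ RR (n + 1) x} ⊆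
      ⋃ m : ℕ, {x | n < m ∧ ¬ (1 ≤ (x m : ℕ) ∧ (x m : ℕ) + 1 < N m)} := by
    intro x hx
    simp only [Set.mem_ofPred_eq, RR, not_forall] at hx
    obtain ⟨m, hm, h⟩ := hx
    exact Set.mem_iUnion.2 ⟨m, hm, h⟩
  have hle : mu N {x | ¬ RR (n + 1) x} ≤ (N n : ENNReal)⁻¹ * (4 * (2⁻¹) ^ n) := by
    calc _ ≤ _ := measure_mono hsub
      _ ≤ _ := measure_iUnion_le _
      _ ≤ ∑' m : ℕ, (N n : ENNReal)⁻¹ * (2 * (2⁻¹) ^ n) * (2⁻¹) ^ m := by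
          refine ENNReal.tsum_le_tsum fun m => ?_
          by_cases hm : n < m
          · simp only [hm, true_and]
            refine (mu_far m 1).trans ?_
            have h1 : (N n : ENNReal) * 2 ^ (n + m) ≤ N m := by
              exact_mod_cast H.hg n m hn hm
            have h2 := ENNReal.inv_le_inv.2 h1
            rw [ENNReal.mul_inv (Or.inl h0) (Or.inl (by simp)), ENNReal.inv_pow, pow_add] at h2
            rw [ENNReal.div_eq_inv_mul]
            calc _ ≤ _ := mul_le_mul_left h2 _
              _ = _ := by push_cast; ring
          · simp [hm]
      _ = _ := by
          rw [ENNReal.tsum_mul_left, ENNReal.tsum_geometric]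
          have : (1 - 2⁻¹ : ENNReal)⁻¹ = 2 := by
            rw [ENNReal.one_sub_inv_two, inv_inv]
          rw [this]; ring
  have h2 := ENNReal.toReal_mono (by
    refine ENNReal.mul_ne_top (by simp [h0]) (ENNReal.mul_ne_top (by simp) (ENNReal.pow_ne_top (by simp)))) hle
  simp only [ENNReal.toReal_mul, ENNReal.toReal_inv, ENNReal.toReal_pow, ENNReal.toReal_natCast] at h2
  have h3 : (0 : ℝ) < N n := by have := H.h2 n; exact_mod_cast (by omega : 0 < N n)
  calc (N n : ℝ) * (mu N).real {x | ¬ RR (n + 1) x} ≤ N n * _ := mul_le_mul_of_nonneg_left h2 h3.le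
    _ = _ := by
      rw [← mul_assoc, mul_inv_cancel₀ h3.ne']; simp

theorem perm_meas (T : XX N → XX N) (n0 : ℕ)
    (h1 : ∀ m, n0 ≤ m → ∀ x y, Agree m x y → Agree m (T x) (T y)) : Measurable T := by
  rw [measurable_pi_iff]
  intro k
  refine measurable_to_countable' fun t => sat_meas (m := max n0 (k + 1)) fun x y h hx => ?_
  simp only [Set.mem_preimage, Set.mem_singleton_iff] at *
  rw [← hx]
  exact (h1 _ (le_max_left _ _) x y h k (by omega)).symm

theorem perm_mp (T : Equiv.Perm (XX N)) (n0 : ℕ)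
    (h1 : ∀ m, n0 ≤ m → ∀ x y, Agree m x y → Agree m (T x) (T y))
    (h2 : ∀ m, n0 ≤ m → ∀ x y, Agree m x y → Agree m (T.symm x) (T.symm y)) :
    MeasurePreserving T (mu N) (mu N) := by
  have hm := perm_meas T n0 h1
  refine ⟨hm, ?_⟩
  have := Measure.isProbabilityMeasure_map (μ := mu N) hm.aemeasurable
  refine ext_of_generate_finite _ (cyl_gen n0) (cyl_pi n0) ?_ (by simp)
  rintro _ ⟨n, hn, a, rfl⟩
  rw [Measure.map_apply hm (cyl_meas n a)]
  have : T ⁻¹' {x | Agree n x a} = {x | Agree n x (T.symm a)} := by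
    ext x
    simp only [Set.mem_preimage, Set.mem_ofPred_eq]
    constructor
    · intro h; simpa using h2 n hn _ _ h
    · intro h; simpa using h1 n hn _ _ h
  rw [this, mu_cyl, mu_cyl]

end TreeConstr

open MeasureTheory

namespace TreeConstr

set_option linter.unusedSectionVars false

variable {N : ℕ → ℕ} [∀ n, NeZero (N n)]

variable (N) in
/-- good points -/
abbrev GX : Type := {x : XX N // Good x}

variable (N) in
/-- the measure on the good points -/
noncomputable def nu : Measure (GX N) := (mu N).comap Subtype.val

theorem map_nu (H : Hyp N) : (nu N).map Subtype.val = mu N := by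
  have := (MeasurableEmbedding.subtype_coe (good_meas (N := N))).map_comap (mu N)
  rw [Subtype.range_coe] at this
  refine Eq.trans this ?_
  exact Measure.restrict_eq_self_of_ae_mem (good_ae H)

theorem nu_apply (H : Hyp N) {s : Set (XX N)} (hs : MeasurableSet s) :
    nu N (Subtype.val ⁻¹' s) = mu N s := by
  rw [← map_nu H, Measure.map_apply measurable_subtype_coe hs]

theorem nu_real (H : Hyp N) {s : Set (XX N)} (hs : MeasurableSet s) :
    (nu N).real (Subtype.val ⁻¹' s) = (mu N).real s := by
  rw [Measure.real, nu_apply H hs, Measure.real]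

theorem nu_prob (H : Hyp N) : IsProbabilityMeasure (nu N) := by
  constructor
  have := nu_apply H MeasurableSet.univ
  simpa using this

theorem lift_mp (H : Hyp N) {T : XX N → XX N} (hT : MeasurePreserving T (mu N) (mu N))
    {T' : GX N → GX N} (h : ∀ x, (T' x).1 = T x.1) : MeasurePreserving T' (nu N) (nu N) := by
  have hm : Measurable T' := by
    refine Measurable.subtype_mk ?_
    simp only [h]
    exact hT.measurable.comp measurable_subtype_coe
  refine ⟨hm, ?_⟩
  ext s hs
  obtain ⟨t, ht, rfl⟩ := hs
  rw [Measure.map_apply hm (measurable_subtype_coe ht), nu_apply H ht]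
  have : T' ⁻¹' (Subtype.val ⁻¹' t) = Subtype.val ⁻¹' (T ⁻¹' t) := by
    ext x; simp [h]
  rw [this, nu_apply H (hT.measurable ht), hT.measure_preimage ht.nullMeasurableSet]

theorem gx_gen : (inferInstance : MeasurableSpace (GX N)) =
    MeasurableSpace.generateFrom (Set.preimage Subtype.val '' (Cyl 0)) := by
  rw [← MeasurableSpace.comap_generateFrom, ← cyl_gen]
  rfl

theorem gx_pi : IsPiSystem (Set.preimage (Subtype.val : GX N → XX N) '' (Cyl 0)) := by
  rintro _ ⟨s, hs, rfl⟩ _ ⟨t, ht, rfl⟩ hne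
  rw [← Set.preimage_inter] at hne ⊢
  exact ⟨_, cyl_pi 0 s hs t ht (hne.elim fun x hx => ⟨x.1, hx⟩), rfl⟩

/-- change coordinate zero -/
noncomputable def st (i : Fin (N 0)) (x : GX N) : GX N :=
  ⟨Function.update x.1 0 i, x.2.of_near 1 fun m hm => by
    rw [Function.update_of_ne (by omega)]; omega⟩

theorem st_of_ne (i : Fin (N 0)) (x : GX N) {n : ℕ} (hn : 1 ≤ n) : (st i x).1 n = x.1 n := by
  simp only [st]; rw [Function.update_of_ne (by omega)]

theorem st_st (i j : Fin (N 0)) (x : GX N) : st i (st j x) = st i x := by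
  simp [st]

theorem st_zero (i : Fin (N 0)) (x : GX N) : (st i x).1 0 = i := by
  simp [st]

theorem st_self (x : GX N) : st (x.1 0) x = x := by
  simp [st]

theorem st_meas (i : Fin (N 0)) : Measurable (st (N := N) i) := by
  refine Measurable.subtype_mk ?_
  refine (perm_meas (fun x : XX N => Function.update x 0 i) 1 ?_).comp measurable_subtype_coe
  intro m hm x y h k hk
  by_cases h0 : k = 0
  · subst h0; simp
  · simp [h0, h k hk]

/-- rotation of coordinate zero -/
def rot (j : Fin (N 0)) : Equiv.Perm (XX N) where
  toFun x := Function.update x 0 (x 0 + j)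
  invFun x := Function.update x 0 (x 0 - j)
  left_inv x := by simp
  right_inv x := by simp

theorem rot_mp (j : Fin (N 0)) : MeasurePreserving (rot j) (mu N) (mu N) := by
  refine perm_mp _ 1 ?_ ?_ <;>
  · intro m hm x y h k hk
    have h1 := h 0 (by omega)
    by_cases h0 : k = 0
    · subst h0; simp [rot, h1]
    · simp [rot, h0, h k hk]

theorem avg (H : Hyp N) (F : GX N → ℝ) (hF : Integrable F (nu N)) :
    (∀ i, Integrable (fun x => F (st i x)) (nu N)) → 
    ∑ i, ∫ x, F (st i x) ∂(nu N) = N 0 * ∫ x, F x ∂(nu N) := by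
  intro hi
  rw [← integral_finsetSum _ (fun i _ => hi i)]
  have h1 : ∀ x : GX N, ∑ i, F (st i x) = ∑ j, F (st (x.1 0 + j) x) := fun x =>
    (Equiv.sum_comp (Equiv.addLeft (x.1 0)) (fun i => F (st i x))).symm
  have h2 : ∀ j : Fin (N 0), MeasurePreserving (fun x : GX N => st (x.1 0 + j) x) (nu N) (nu N) :=
    fun j => lift_mp H (rot_mp j) (fun x => rfl)
  simp only [h1]
  rw [integral_finsetSum _ (fun j _ => (show Integrable (fun x => F (st (x.1 0 + j) x)) _ from
    (h2 j).integrable_comp_of_integrable hF))]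
  have h3 : ∀ j : Fin (N 0), ∫ x, F (st (x.1 0 + j) x) ∂(nu N) = ∫ x, F x ∂(nu N) := by
    intro j
    have := integral_map (h2 j).measurable.aemeasurable (f := F)
      (by rw [(h2 j).map_eq]; exact hF.aestronglyMeasurable)
    rw [(h2 j).map_eq] at this
    exact this.symm
  simp [h3]

theorem idx_meas : Measurable (idx : XX N → ℕ) := by
  refine measurable_of_Ici fun n => ?_
  have : (idx ⁻¹' Set.Ici n : Set (XX N)) =
      (⋃ m, {x | RR m x})ᶜ ∩ {_x | n = 0} ∪ (⋃ m, {x | RR m x}) ∩ (⋂ m, ⋂ (_ : m < n), {x | RR m x}ᶜ) := by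
    ext x
    simp only [Set.mem_preimage, Set.mem_Ici, Set.mem_union, Set.mem_inter_iff, Set.mem_compl_iff,
      Set.mem_iUnion, Set.mem_ofPred_eq, Set.mem_iInter]
    by_cases h : ∃ m, RR m x
    · simp only [h, not_true, false_and, true_and, false_or]
      constructor
      · intro hn m hm hr; have := idx_le hr; omega
      · intro hn
        by_contra hc
        exact hn _ (not_le.1 hc) (Nat.sInf_mem (s := {n | RR n x}) h)
    · simp only [h, not_false_eq_true, true_and, false_and, or_false]
      have : idx x = 0 := by
        unfold idx
        rw [show {n | RR n x} = ∅ by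
          ext m; simpa using fun hm => h ⟨m, hm⟩]
        simp
      omega
  rw [this]
  have h1 : MeasurableSet (⋃ m, {x : XX N | RR m x}) := MeasurableSet.iUnion rr_meas
  refine (h1.compl.inter (MeasurableSet.const _)).union (h1.inter ?_)
  exact MeasurableSet.iInter fun m => MeasurableSet.iInter fun _ => (rr_meas m).compl

theorem Lim_meas {A : ℕ → XX N → XX N} (hA : ∀ n, Measurable (A n)) : Measurable (Lim A) := by
  rw [measurable_pi_iff]
  intro k
  have h1 : Measurable (fun p : ℕ × XX N => A (max p.1 (k + 1)) p.2 k) :=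
    measurable_from_prod_countable_right fun n => (measurable_pi_apply k).comp (hA (max n (k + 1)))
  exact h1.comp (idx_meas.prodMk measurable_id)

variable (S : Sched N)

theorem Th_mp (n : ℕ) : MeasurePreserving (S.Th n) (mu N) (mu N) :=
  perm_mp _ n (fun _ hm _ _ h => S.Th_agree hm h) (fun _ hm _ _ h => S.Thi_agree hm h)

theorem theta_meas : Measurable S.theta := by
  refine Measurable.subtype_mk ?_
  exact (Lim_meas (A := fun n x => S.Th n x) fun n => (Th_mp S n).measurable).comp measurable_subtype_coe

theorem theta_symm_meas : Measurable S.theta.symm := by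
  refine Measurable.subtype_mk ?_
  exact (Lim_meas (A := fun n x => (S.Th n)⁻¹ x) fun n => perm_meas _ n
    fun _ hm _ _ h => S.Thi_agree hm h).comp measurable_subtype_coe

theorem theta_mp (H : Hyp N) : MeasurePreserving S.theta (nu N) (nu N) := by
  have hm := theta_meas S
  have := nu_prob H
  refine ⟨hm, ?_⟩
  have := Measure.isProbabilityMeasure_map (μ := nu N) hm.aemeasurable
  refine ext_of_generate_finite _ gx_gen gx_pi ?_ (by simp)
  rintro _ ⟨_, ⟨n, hn, a, rfl⟩, rfl⟩
  have hcm := cyl_meas n a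
  rw [Measure.map_apply hm (measurable_subtype_coe hcm), nu_apply H hcm]
  set t := {x | Agree n x a} with ht
  set s := S.theta ⁻¹' (Subtype.val ⁻¹' t) with hs
  have key : ∀ m, n ≤ m → ∀ x : GX N, RR m x.1 → (x ∈ s ↔ x.1 ∈ S.Th m ⁻¹' t) := by
    intro m hnm x hx
    have h1 := (S.Lim_Th x.2 hx).mono hnm
    simp only [hs, ht, Set.mem_preimage, Set.mem_ofPred_eq, S.theta_val]
    exact ⟨fun h => h1.symm.trans h, fun h => h1.trans h⟩
  have hr : (nu N).real s = (mu N).real t := by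
    have hT : ∀ m, (nu N).real (Subtype.val ⁻¹' (S.Th m ⁻¹' t)) = (mu N).real t := by
      intro m
      rw [nu_real H ((Th_mp S m).measurable hcm), Measure.real,
        (Th_mp S m).measure_preimage hcm.nullMeasurableSet, Measure.real]
    have hb : ∀ m, 1 ≤ m → (nu N).real (Subtype.val ⁻¹' {x | ¬ RR (m + 1) x}) ≤ 4 * (1 / 2) ^ m := by
      intro m h
      have h0 := nu_real H (s := {x : XX N | ¬ RR (m + 1) x}) (rr_meas (m + 1)).compl
      rw [h0]
      have h1 : (1 : ℝ) ≤ N m := by have := H.h2 m; exact_mod_cast (by omega : 1 ≤ N m)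
      have h2 : 0 ≤ (mu N).real {x | ¬ RR (m + 1) x} := measureReal_nonneg
      nlinarith [mu_tail H h]
    have hlim : ∀ ε : ℝ, 0 < ε → ∃ m, n ≤ m + 1 ∧ 1 ≤ m ∧ 4 * (1 / 2 : ℝ) ^ m ≤ ε := by
      intro ε hε
      obtain ⟨m, hm⟩ := exists_pow_lt_of_lt_one (show 0 < ε / 4 by positivity)
        (show (1 / 2 : ℝ) < 1 by norm_num)
      refine ⟨m + n + 1, by omega, by omega, ?_⟩
      have : (1 / 2 : ℝ) ^ (m + n + 1) ≤ (1 / 2) ^ m :=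
        pow_le_pow_of_le_one (by norm_num) (by norm_num) (by omega)
      linarith
    apply le_antisymm
    · refine le_of_forall_pos_le_add fun ε hε => ?_
      obtain ⟨m, h1, h2, h3⟩ := hlim ε hε
      have hsub : s ⊆ (Subtype.val ⁻¹' (S.Th (m + 1) ⁻¹' t)) ∪
          (Subtype.val ⁻¹' {x | ¬ RR (m + 1) x}) := by
        intro x hx
        by_cases hr : RR (m + 1) x.1
        · exact Or.inl ((key _ h1 x hr).1 hx)
        · exact Or.inr hr
      calc _ ≤ _ := measureReal_mono hsub
        _ ≤ _ := measureReal_union_le _ _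
        _ ≤ _ := by rw [hT]; linarith [hb m h2]
    · refine le_of_forall_pos_le_add fun ε hε => ?_
      obtain ⟨m, h1, h2, h3⟩ := hlim ε hε
      have hsub : (Subtype.val ⁻¹' (S.Th (m + 1) ⁻¹' t)) ⊆ s ∪
          (Subtype.val ⁻¹' {x | ¬ RR (m + 1) x}) := by
        intro x hx
        by_cases hr : RR (m + 1) x.1
        · exact Or.inl ((key _ h1 x hr).2 hx)
        · exact Or.inr hr
      rw [← hT (m + 1)]
      calc _ ≤ _ := measureReal_mono hsub
        _ ≤ _ := measureReal_union_le _ _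
        _ ≤ _ := by linarith [hb m h2]
  exact (ENNReal.toReal_eq_toReal_iff' (by finiteness) (by finiteness)).1 hr

end TreeConstr

open MeasureTheory

namespace TreeConstr

set_option linter.unusedSectionVars false

variable {N : ℕ → ℕ} [∀ n, NeZero (N n)] (S : Sched N)

theorem int_bdd (H : Hyp N) {f : GX N → ℝ} (hf : Measurable f) {K : ℝ} (hb : ∀ x, |f x| ≤ K) :
    Integrable f (nu N) := by
  have := nu_prob H
  exact Integrable.of_bound hf.aestronglyMeasurable K (Filter.Eventually.of_forall hb)

theorem orth (H : Hyp N) {F g : GX N → ℝ} (hF : Measurable F) (hFb : ∀ x, |F x| ≤ 1)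
    (hg : Measurable g) {K : ℝ} (hgb : ∀ x, |g x| ≤ K) (hgs : ∀ i x, g (st i x) = g x)
    (h : ∀ᵐ x ∂(nu N), ∑ i, F (st i x) = 0) : ∫ x, F x * g x ∂(nu N) = 0 := by
  have hb : ∀ x, |F x * g x| ≤ 1 * K := fun x => by
    rw [abs_mul]
    exact mul_le_mul (hFb x) (hgb x) (abs_nonneg _) zero_le_one
  have hi : ∀ i, Integrable (fun x => F (st i x) * g (st i x)) (nu N) := fun i =>
    int_bdd H ((hF.mul hg).comp (st_meas i)) (fun x => hb _)
  have h1 := avg H (fun x => F x * g x) (int_bdd H (hF.mul hg) hb) hi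
  rw [← integral_finsetSum _ (fun i _ => hi i)] at h1
  have h2 : ∫ x, ∑ i, F (st i x) * g (st i x) ∂(nu N) = 0 := by
    rw [integral_eq_zero_of_ae]
    filter_upwards [h] with x hx
    simp only [hgs, ← Finset.sum_mul, hx, zero_mul, Pi.zero_apply]
  rw [h2] at h1
  have : (N 0 : ℝ) ≠ 0 := by exact_mod_cast NeZero.ne (N 0)
  exact (mul_eq_zero.1 h1.symm).resolve_left this

open Classical in
theorem ptwise {n : ℕ} (hv : S.Valid n) (x : GX N) :
    |((if Agree (S.k n) x.1 (S.a n) then (1 : ℝ) else 0) -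
      (if Agree (S.k n) x.1 (S.b n) then (1 : ℝ) else 0)) -
      ((((S.theta x).1 n : ℕ) : ℝ) - ((x.1 n : ℕ) : ℝ))| ≤
    2 * (if ¬ (0 < (x.1 n : ℕ) ∧ (x.1 n : ℕ) + 1 < N n) then 1 else 0) +
      2 * N n * (if ¬ RR (n + 1) x.1 then 1 else 0) := by
  have hab : |((if Agree (S.k n) x.1 (S.a n) then (1 : ℝ) else 0) -
      (if Agree (S.k n) x.1 (S.b n) then (1 : ℝ) else 0))| ≤ 1 := by
    split_ifs <;> simp
  by_cases hr : RR (n + 1) x.1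
  · have hth : (S.theta x).1 n = S.c n x.1 n := by
      rw [S.theta_val]; exact S.Lim_Th_apply x.2 hr
    rw [hth]
    by_cases he : 0 < (x.1 n : ℕ) ∧ (x.1 n : ℕ) + 1 < N n
    · have h1 := S.c_diff hv he.1 he.2
      have h2 : (((S.c n x.1 n : ℕ) : ℝ) - ((x.1 n : ℕ) : ℝ)) =
        ((if Agree (S.k n) x.1 (S.a n) then (1 : ℝ) else 0) -
          (if Agree (S.k n) x.1 (S.b n) then (1 : ℝ) else 0)) := by
        exact_mod_cast h1
      rw [h2, sub_self, abs_zero]; positivity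
    · have h1 := S.c_near n x.1
      have h2 : |((S.c n x.1 n : ℕ) : ℝ) - ((x.1 n : ℕ) : ℝ)| ≤ 1 := by
        rw [abs_le]
        have h3 : ((S.c n x.1 n : ℕ) : ℝ) ≤ (x.1 n : ℕ) + 1 := by exact_mod_cast h1.1
        have h4 : ((x.1 n : ℕ) : ℝ) ≤ (S.c n x.1 n : ℕ) + 1 := by exact_mod_cast h1.2
        constructor <;> linarith
      simp only [he, hr, not_true, not_false_eq_true, if_true, if_false]
      refine (abs_sub _ _).trans ?_
      linarith
  · have h1 : (1 : ℝ) ≤ N n := by exact_mod_cast NeZero.one_le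
    have h2 : (((S.theta x).1 n : ℕ) : ℝ) ≤ N n := by exact_mod_cast ((S.theta x).1 n).2.le
    have h3 : ((x.1 n : ℕ) : ℝ) ≤ N n := by exact_mod_cast (x.1 n).2.le
    have h4 : (0 : ℝ) ≤ (((S.theta x).1 n : ℕ) : ℝ) := by positivity
    have h5 : (0 : ℝ) ≤ ((x.1 n : ℕ) : ℝ) := by positivity
    have h6 : |(((S.theta x).1 n : ℕ) : ℝ) - ((x.1 n : ℕ) : ℝ)| ≤ N n := by
      rw [abs_le]; constructor <;> linarith
    have h7 : (0 : ℝ) ≤ 2 * (if ¬ (0 < (x.1 n : ℕ) ∧ (x.1 n : ℕ) + 1 < N n) then 1 else 0) := by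
      positivity
    refine (abs_sub _ _).trans ?_
    simp only [hr, not_false_eq_true, if_true]
    linarith

open Classical in
theorem int_ind (H : Hyp N) {p : XX N → Prop} (hp : MeasurableSet {x | p x}) :
    ∫ x : GX N, (if p x.1 then (1 : ℝ) else 0) ∂(nu N) = (mu N).real {x | p x} := by
  rw [← nu_real H hp]
  have := nu_prob H
  rw [← integral_indicator_one (measurable_subtype_coe hp)]
  congr 1

open Classical in
/-- integral over a cylinder -/
noncomputable def cylint (f : GX N → ℝ) (k : ℕ) (a : XX N) : ℝ :=
  ∫ x, (if Agree k x.1 a then f x else 0) ∂(nu N)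

open Classical in
theorem cylint_int (H : Hyp N) {f : GX N → ℝ} (hf : Measurable f) (hb : ∀ x, |f x| ≤ 1)
    (k : ℕ) (a : XX N) : Integrable (fun x => if Agree k x.1 a then f x else 0) (nu N) := by
  refine int_bdd H (K := 1) (Measurable.ite (measurable_subtype_coe (cyl_meas k a)) hf
    measurable_const) fun x => ?_
  split_ifs
  · exact hb x
  · simp

open Classical in
theorem cylint_congr {f : GX N → ℝ} {k : ℕ} {a b : XX N} (h : Agree k a b) :
    cylint f k a = cylint f k b := by
  unfold cylint
  have : ∀ x : GX N, Agree k x.1 a ↔ Agree k x.1 b :=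
    fun x => ⟨fun h' => h'.trans h, fun h' => h'.trans h.symm⟩
  refine integral_congr_ae (Filter.Eventually.of_forall fun x => ?_)
  exact if_congr (this x) rfl rfl

theorem coord_meas (n : ℕ) : Measurable (fun x : GX N => ((x.1 n : ℕ) : ℝ)) := by
  have : Measurable (fun i : Fin (N n) => ((i : ℕ) : ℝ)) := measurable_of_finite _
  exact this.comp ((measurable_pi_apply n).comp measurable_subtype_coe)

open Classical in
theorem cylint_near (H : Hyp N) {f : GX N → ℝ} (hf : Measurable f) (hb : ∀ x, |f x| ≤ 1)
    (h1 : ∀ᵐ x ∂(nu N), ∑ i, f (st i x) = 0)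
    (h2 : ∀ᵐ x ∂(nu N), ∑ i, f (S.theta.symm (st i x)) = 0) {n : ℕ} (hv : S.Valid n) :
    |cylint f (S.k n) (S.a n) - cylint f (S.k n) (S.b n)| ≤ 12 * (1 / 2) ^ n := by
  have := nu_prob H
  let g : GX N → ℝ := fun x => ((x.1 n : ℕ) : ℝ)
  have hgm : Measurable g := coord_meas n
  have hgb : ∀ x, |g x| ≤ N n := fun x => by
    simp only [g, Nat.abs_cast]
    exact_mod_cast (x.1 n).2.le
  have hgs : ∀ i x, g (st i x) = g x := fun i x => by simp only [g, st_of_ne i x hv.1]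
  have o1 : ∫ x, f x * g x ∂(nu N) = 0 := orth H hf hb hgm hgb hgs h1
  have o2 : ∫ x, f x * g (S.theta x) ∂(nu N) = 0 := by
    have o3 := orth H (F := fun x => f (S.theta.symm x)) (hf.comp (theta_symm_meas S))
      (fun x => hb _) hgm hgb hgs h2
    have hmp := theta_mp S H
    rw [← hmp.map_eq, integral_map hmp.measurable.aemeasurable] at o3
    · simpa using o3
    · exact ((hf.comp (theta_symm_meas S)).mul hgm).aestronglyMeasurable
  have i1 : Integrable (fun x => f x * g x) (nu N) := int_bdd H (hf.mul hgm) (K := 1 * N n)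
    (fun x => by rw [abs_mul]; exact mul_le_mul (hb x) (hgb x) (abs_nonneg _) zero_le_one)
  have i2 : Integrable (fun x => f x * g (S.theta x)) (nu N) :=
    int_bdd H (hf.mul (hgm.comp (theta_meas S))) (K := 1 * N n)
    (fun x => by rw [abs_mul]; exact mul_le_mul (hb x) (hgb _) (abs_nonneg _) zero_le_one)
  have ia := cylint_int H hf hb (S.k n) (S.a n)
  have ib := cylint_int H hf hb (S.k n) (S.b n)
  have e : cylint f (S.k n) (S.a n) - cylint f (S.k n) (S.b n) =
      ∫ x, (((if Agree (S.k n) x.1 (S.a n) then f x else 0) -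
        (if Agree (S.k n) x.1 (S.b n) then f x else 0)) -
        (f x * g (S.theta x) - f x * g x)) ∂(nu N) := by
    refine Eq.trans ?_ (integral_sub (ia.sub ib) (i2.sub i1)).symm
    have e1 := integral_sub ia ib
    have e2 := integral_sub i2 i1
    rw [o1, o2, sub_zero] at e2
    simp only [Pi.sub_apply]
    rw [e1, e2, sub_zero]
    simp [cylint]
  rw [e, ← Real.norm_eq_abs]
  have hE : MeasurableSet {x : XX N | ¬ (0 < (x n : ℕ) ∧ (x n : ℕ) + 1 < N n)} :=
    (measurable_pi_apply n : Measurable fun x : XX N => x n)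
      (Set.toFinite {i : Fin (N n) | ¬ (0 < (i : ℕ) ∧ (i : ℕ) + 1 < N n)}).measurableSet
  have hR : MeasurableSet {x : XX N | ¬ RR (n + 1) x} := (rr_meas (n + 1)).compl
  have hint : ∀ {p : XX N → Prop}, MeasurableSet {x | p x} →
      Integrable (fun x : GX N => if p x.1 then (1 : ℝ) else 0) (nu N) := by
    intro p hp
    refine int_bdd H (K := 1) (Measurable.ite (measurable_subtype_coe hp) measurable_const
      measurable_const) fun x => ?_
    split_ifs <;> simp
  have jE := (hint hE).const_mul 2
  have jR := (hint hR).const_mul (2 * N n)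
  refine (norm_integral_le_of_norm_le (jE.add jR) (Filter.Eventually.of_forall fun x => ?_)).trans ?_
  · have hp := ptwise S hv x
    have : ((if Agree (S.k n) x.1 (S.a n) then f x else 0) -
        (if Agree (S.k n) x.1 (S.b n) then f x else 0)) -
        (f x * g (S.theta x) - f x * g x) = f x *
        (((if Agree (S.k n) x.1 (S.a n) then (1 : ℝ) else 0) -
      (if Agree (S.k n) x.1 (S.b n) then (1 : ℝ) else 0)) -
      ((((S.theta x).1 n : ℕ) : ℝ) - ((x.1 n : ℕ) : ℝ))) := by
      simp only [g]
      split_ifs <;> ring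
    rw [this, Real.norm_eq_abs, abs_mul]
    refine (mul_le_of_le_one_left (abs_nonneg _) (hb x)).trans ?_
    refine hp.trans (le_of_eq ?_)
    simp only [Pi.add_apply]
    congr
  · simp only [Pi.add_apply]
    rw [integral_add jE jR, integral_const_mul, integral_const_mul, int_ind H hE, int_ind H hR]
    have m1 := mu_end H n
    have m2 := mu_tail H hv.1
    linarith

theorem cylint_eq (H : Hyp N) {f : GX N → ℝ} (hf : Measurable f) (hb : ∀ x, |f x| ≤ 1)
    (h1 : ∀ᵐ x ∂(nu N), ∑ i, f (st i x) = 0)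
    (h2 : ∀ᵐ x ∂(nu N), ∑ i, f (S.theta.symm (st i x)) = 0) (k : ℕ) (a b : XX N) :
    cylint f k a = cylint f k b := by
  by_cases hab : Agree k a b
  · exact cylint_congr hab
  rw [← sub_eq_zero, ← abs_eq_zero]
  refine le_antisymm (le_of_forall_pos_le_add fun ε hε => ?_) (abs_nonneg _)
  obtain ⟨M, hM⟩ := exists_pow_lt_of_lt_one (show 0 < ε / 12 by positivity)
    (show (1 / 2 : ℝ) < 1 by norm_num)
  obtain ⟨n, hn, hk, ha, hbb⟩ := S.freq k a b (M + k + 1)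
  have hv : S.Valid n := ⟨by omega, by omega, fun h => hab (by
    rw [hk] at h; exact (ha.symm.trans h).trans hbb)⟩
  have := cylint_near S H hf hb h1 h2 hv
  rw [hk, cylint_congr ha, cylint_congr hbb] at this
  have h3 : (1 / 2 : ℝ) ^ n ≤ (1 / 2) ^ M :=
    pow_le_pow_of_le_one (by norm_num) (by norm_num) (by omega)
  linarith

open Classical in
theorem cylint_zero (H : Hyp N) {f : GX N → ℝ} (hf : Measurable f) (hb : ∀ x, |f x| ≤ 1)
    (h1 : ∀ᵐ x ∂(nu N), ∑ i, f (st i x) = 0)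
    (h2 : ∀ᵐ x ∂(nu N), ∑ i, f (S.theta.symm (st i x)) = 0) (k : ℕ) (a : XX N) :
    cylint f k a = 0 := by
  have h0 : ∫ x, f x ∂(nu N) = 0 := by
    have := orth H (g := fun _ => 1) hf hb measurable_const (K := 1) (by simp) (by simp) h1
    simpa using this
  let e : (∀ i : Fin k, Fin (N i)) → XX N := fun p n => if h : n < k then p ⟨n, h⟩ else 0
  have he : ∀ p, pre k (e p) = p := by
    intro p; funext i; simp [pre, e]
  have hs : ∀ x : GX N, f x = ∑ p, (if Agree k x.1 (e p) then f x else 0) := by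
    intro x
    have : ∀ p, Agree k x.1 (e p) ↔ pre k x.1 = p := fun p => by rw [← pre_eq_iff, he]
    simp only [this]
    simp
  have h3 : ∫ x, f x ∂(nu N) = ∑ p, cylint f k (e p) := by
    unfold cylint
    rw [← integral_finsetSum _ (fun p _ => cylint_int H hf hb k (e p))]
    exact integral_congr_ae (Filter.Eventually.of_forall hs)
  rw [h0, Finset.sum_congr rfl (fun p _ => cylint_eq S H hf hb h1 h2 k (e p) a)] at h3
  rw [Finset.sum_const, nsmul_eq_mul] at h3
  refine (mul_eq_zero.1 h3.symm).resolve_left ?_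
  have : Nonempty (∀ i : Fin k, Fin (N i)) := ⟨pre k a⟩
  exact_mod_cast (Finset.card_pos.2 Finset.univ_nonempty).ne'

theorem circ (H : Hyp N) {f : GX N → ℝ} (hf : Measurable f) (hb : ∀ x, |f x| ≤ 1)
    (h1 : ∀ᵐ x ∂(nu N), ∑ i, f (st i x) = 0)
    (h2 : ∀ᵐ x ∂(nu N), ∑ i, f (S.theta.symm (st i x)) = 0) :
    ∀ᵐ x ∂(nu N), f x = 0 := by
  have hi := int_bdd H hf hb
  have h0 : ∫ x, f x ∂(nu N) = 0 := by
    have := orth H (g := fun _ => 1) hf hb measurable_const (K := 1) (by simp) (by simp) h1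
    simpa using this
  refine hi.ae_eq_zero_of_forall_setIntegral_eq_zero fun s hs _ => ?_
  refine MeasurableSpace.induction_on_inter (C := fun s _ => ∫ x in s, f x ∂(nu N) = 0)
    gx_gen gx_pi ?_ ?_ ?_ ?_ s hs
  · simp
  · rintro _ ⟨_, ⟨n, hn, a, rfl⟩, rfl⟩
    rw [← cylint_zero S H hf hb h1 h2 n a, ← integral_indicator (measurable_subtype_coe (cyl_meas n a))]
    unfold cylint
    congr 1
  · intro t ht ih
    have := integral_add_compl ht hi
    rw [ih] at this
    linarith
  · intro t hd hm ih
    rw [integral_iUnion hm hd hi.integrableOn]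
    simp [ih]

open Classical in
theorem sep (H : Hyp N) (F : Finset (GX N)) (x0 : GX N) (hx0 : x0 ∈ F) :
    ∃ g : GX N → ℤ, (∀ i x, g (st i x) = g x) ∧
      ∀ x ∈ F, g (S.theta x) - g x = if x = x0 then 1 else 0 := by
  have hnt : ∀ n, Nontrivial (Fin (N n)) := fun n => by
    have := H.h2 n
    exact Fin.nontrivial_iff_two_le.2 this
  have hinf : Infinite (XX N) := Pi.infinite_of_left
  obtain ⟨y, hy⟩ := Infinite.exists_notMem_finset (F.image Subtype.val)
  have hdist : ∀ z x : XX N, ∃ k, Agree k x z → x = z := by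
    intro z x
    by_contra hc
    push Not at hc
    exact (hc 0).2 (eq_of_agree 0 fun n _ => (hc n).1)
  choose K hK using hdist
  have hRR : ∀ x : GX N, RR (idx x.1) x.1 := fun x => idx_spec x.2
  let k := F.sup (fun x => K x0.1 x.1) + F.sup (fun x => K y x.1)
  let M := F.sup (fun x => idx x.1)
  obtain ⟨n, hn, hk, ha, hb⟩ := S.freq k x0.1 y (M + k + 1)
  have hkx : ∀ x ∈ F, ∀ j, k ≤ j → Agree j x.1 x0.1 → x.1 = x0.1 := by
    intro x hx j hj h
    refine hK x0.1 x.1 (h.mono ?_)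
    have : K x0.1 x.1 ≤ F.sup (fun x => K x0.1 x.1) := Finset.le_sup (f := fun x : GX N => K x0.1 x.1) hx
    omega
  have hky : ∀ x ∈ F, ∀ j, k ≤ j → ¬ Agree j x.1 y := by
    intro x hx j hj h
    refine hy (Finset.mem_image.2 ⟨x, hx, hK y x.1 (h.mono ?_)⟩)
    have : K y x.1 ≤ F.sup (fun x => K y x.1) := Finset.le_sup (f := fun x : GX N => K y x.1) hx
    omega
  have hv : S.Valid n := ⟨by omega, by omega, fun h => by
    rw [hk] at h
    exact hky x0 hx0 k le_rfl ((ha.symm.trans h).trans hb)⟩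
  refine ⟨fun x => ((x.1 n : ℕ) : ℤ), fun i x => by simp only [st_of_ne i x hv.1], fun x hx => ?_⟩
  have hle : idx x.1 ≤ M := Finset.le_sup (f := fun x : GX N => idx x.1) hx
  have hr : RR n x.1 := (hRR x).mono (by omega)
  have hth : (S.theta x).1 n = S.c n x.1 n := by
    rw [S.theta_val]; exact S.Lim_Th_apply x.2 (hr.mono (by omega))
  simp only [hth]
  have hd := hr n le_rfl
  rw [S.c_diff hv hd.1 hd.2, hk]
  have hB : ¬ Agree k x.1 (S.b n) := fun h => hky x hx k le_rfl (h.trans hb)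
  have hA : Agree k x.1 (S.a n) ↔ x = x0 := by
    constructor
    · intro h; exact Subtype.ext (hkx x hx k le_rfl (h.trans ha))
    · rintro rfl; exact ha.symm
  simp [hA, hB]

end TreeConstr

open MeasureTheory

namespace TreeConstr

set_option linter.unusedSectionVars false

open Classical in
/-- abstract data from which the treeing is built -/
structure Model (d : ℕ) where
  X : Type
  [mX : MeasurableSpace X]
  [sb : StandardBorelSpace X]
  μ : Measure X
  [prob : IsProbabilityMeasure μ]
  st : Fin d → X → X
  co : X → Fin d
  θ : Equiv.Perm X
  st_st : ∀ i j x, st i (st j x) = st i x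
  co_st : ∀ i x, co (st i x) = i
  st_co : ∀ x, st (co x) x = x
  st_meas : ∀ i, Measurable (st i)
  co_meas : Measurable co
  θ_meas : Measurable θ
  θ_symm_meas : Measurable θ.symm
  θ_mp : MeasurePreserving θ μ μ
  avg : ∀ F : X → ℝ, Measurable F → (∃ K, ∀ x, |F x| ≤ K) →
    ∑ i, ∫ x, F (st i x) ∂μ = d * ∫ x, F x ∂μ
  circ : ∀ f : X → ℝ, Measurable f → (∀ x, |f x| ≤ 1) → (∀ᵐ x ∂μ, ∑ i, f (st i x) = 0) →
    (∀ᵐ x ∂μ, ∑ i, f (θ.symm (st i x)) = 0) → ∀ᵐ x ∂μ, f x = 0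
  sep : ∀ (F : Finset X) (x0 : X), x0 ∈ F → ∃ g : X → ℤ, (∀ i x, g (st i x) = g x) ∧
    ∀ x ∈ F, g (θ x) - g x = if x = x0 then 1 else 0

attribute [instance] Model.mX Model.sb Model.prob

/-- the concrete sizes -/
def NN (m : ℕ) : ℕ → ℕ
  | 0 => 2 * m
  | (n + 1) => 2 ^ ((n + 1) ^ 2 + 1)

theorem NN_hyp {m : ℕ} (hm : 1 ≤ m) : Hyp (NN m) where
  h2 n := by
    cases n with
    | zero => simp only [NN]; omega
    | succ n =>
      simp only [NN]
      calc 2 = 2 ^ 1 := rfl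
        _ ≤ _ := Nat.pow_le_pow_right (by norm_num) (by omega)
  hg n k hn hk := by
    obtain ⟨a, rfl⟩ : ∃ a, n = a + 1 := ⟨n - 1, by omega⟩
    obtain ⟨b, rfl⟩ : ∃ b, k = a + 1 + b + 1 := ⟨k - (a + 2), by omega⟩
    simp only [NN]
    rw [← pow_add]
    refine Nat.pow_le_pow_right (by norm_num) ?_
    nlinarith [Nat.zero_le a, Nat.zero_le b, Nat.zero_le (a * b), Nat.zero_le (b * b)]

theorem exists_model {m : ℕ} (hm : 1 ≤ m) : Nonempty (Model (2 * m)) := by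
  have H := NN_hyp hm
  have hz : ∀ n, NeZero (NN m n) := fun n => ⟨by have := H.h2 n; omega⟩
  obtain ⟨S⟩ := exists_sched H.h2
  have := nu_prob H
  have : StandardBorelSpace (GX (NN m)) := (good_meas (N := NN m)).standardBorel
  change Nonempty (Model (NN m 0))
  refine ⟨{
    X := GX (NN m)
    μ := nu (NN m)
    st := st
    co := fun x => x.1 0
    θ := S.theta
    st_st := st_st
    co_st := st_zero
    st_co := st_self
    st_meas := st_meas
    co_meas := (measurable_pi_apply 0).comp measurable_subtype_coe
    θ_meas := theta_meas S
    θ_symm_meas := theta_symm_meas S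
    θ_mp := theta_mp S H
    avg := fun F hF hb => hb.elim fun K hK => avg H F (int_bdd H hF hK)
      fun i => int_bdd H (hF.comp (st_meas i)) fun x => hK _
    circ := fun f hf hb h1 h2 => circ S H hf hb h1 h2
    sep := fun F x0 h => by
      obtain ⟨g, h1, h2⟩ := sep S H F x0 h
      refine ⟨g, h1, fun x hx => (h2 x hx).trans ?_⟩
      congr }⟩

namespace Model

variable {d : ℕ} [NeZero d] (M : Model d)

/-- the vertex space -/
abbrev V : Type := {x : M.X // M.co x = 0} × Bool

theorem base_meas : MeasurableSet {x : M.X | M.co x = 0} :=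
  M.co_meas (measurableSet_singleton 0)

instance : StandardBorelSpace M.V := by
  have : StandardBorelSpace {x : M.X // M.co x = 0} := M.base_meas.standardBorel
  infer_instance

/-- the vertex below a point -/
def zz (x : M.X) : {x : M.X // M.co x = 0} := ⟨M.st 0 x, M.co_st 0 x⟩

/-- twist -/
def tb : Bool → Equiv.Perm M.X
  | false => 1
  | true => M.θ

/-- end points of an edge -/
def ep (b : Bool) (x : M.X) : M.V := (M.zz (M.tb b x), b)

/-- edges at a vertex -/
def ed (i : Fin d) (u : M.V) : M.X := (M.tb u.2).symm (M.st i u.1.1)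

/-- neighbours -/
def nb (i : Fin d) (u : M.V) : M.V := M.ep (!u.2) (M.ed i u)

theorem ep_ed (i : Fin d) (u : M.V) : M.ep u.2 (M.ed i u) = u := by
  obtain ⟨⟨y, hy⟩, b⟩ := u
  simp only [ep, ed, zz, Equiv.apply_symm_apply, M.st_st]
  have : M.st 0 y = y := by rw [← hy]; exact M.st_co y
  simp [this]

theorem ed_ep' (i : Fin d) (b : Bool) (x : M.X) :
    M.ed i (M.ep b x) = (M.tb b).symm (M.st i (M.tb b x)) := by
  simp [ed, ep, zz, M.st_st]

theorem ed_ep (b : Bool) (x : M.X) : M.ed (M.co (M.tb b x)) (M.ep b x) = x := by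
  rw [ed_ep', M.st_co]; simp

theorem zz_meas : Measurable M.zz := (M.st_meas 0).subtype_mk

theorem tb_meas (b : Bool) : Measurable (M.tb b) := by
  cases b
  · exact measurable_id
  · exact M.θ_meas

theorem tb_symm_meas (b : Bool) : Measurable (M.tb b).symm := by
  cases b
  · exact measurable_id
  · exact M.θ_symm_meas

theorem tb_mp (b : Bool) : MeasurePreserving (M.tb b) M.μ M.μ := by
  cases b
  · exact MeasurePreserving.id _
  · exact M.θ_mp

theorem tb_symm_mp (b : Bool) : MeasurePreserving (M.tb b).symm M.μ M.μ := by
  let e : M.X ≃ᵐ M.X := ⟨M.tb b, M.tb_meas b, M.tb_symm_meas b⟩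
  exact MeasurePreserving.symm e (M.tb_mp b)

theorem ep_meas (b : Bool) : Measurable (M.ep b) :=
  (M.zz_meas.comp (M.tb_meas b)).prodMk measurable_const

theorem ed_meas (i : Fin d) : Measurable (M.ed i) := by
  have h : Measurable (fun p : {x : M.X // M.co x = 0} × Bool => M.ed i p) := by
    refine measurable_from_prod_countable_left fun b => ?_
    exact (M.tb_symm_meas b).comp ((M.st_meas i).comp measurable_subtype_coe)
  exact h

theorem nb_meas (i : Fin d) : Measurable (M.nb i) := by
  have h : Measurable (fun p : M.X × Bool => M.ep (!p.2) p.1) :=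
    measurable_from_prod_countable_left fun b => M.ep_meas (!b)
  exact h.comp ((M.ed_meas i).prodMk measurable_snd)

/-- the edge set -/
def E : Set (M.V × M.V) := {p | ∃ i, M.nb i p.1 = p.2}

theorem E_meas : MeasurableSet M.E := by
  have : M.E = ⋃ i, {p | M.nb i p.1 = p.2} := by ext p; simp [E]
  rw [this]
  exact MeasurableSet.iUnion fun i =>
    measurableSet_eq_fun ((M.nb_meas i).comp measurable_fst) measurable_snd

theorem mem_E {u v : M.V} : (u, v) ∈ M.E ↔ ∃ x, M.ep u.2 x = u ∧ M.ep (!u.2) x = v := by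
  constructor
  · rintro ⟨i, h⟩
    exact ⟨M.ed i u, M.ep_ed i u, h⟩
  · rintro ⟨x, h1, h2⟩
    refine ⟨M.co (M.tb u.2 x), ?_⟩
    have h3 : M.ed (M.co (M.tb u.2 x)) u = x := by
      conv_lhs => rw [← h1]
      exact M.ed_ep u.2 x
    simp only [nb, h3]
    exact h2

theorem E_flip {u v : M.V} (h : (u, v) ∈ M.E) : v.2 = !u.2 := by
  obtain ⟨i, h⟩ := h
  exact (congrArg Prod.snd h).symm

theorem E_symm (u v : M.V) (h : (u, v) ∈ M.E) : (v, u) ∈ M.E := by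
  have hf := M.E_flip h
  obtain ⟨x, h1, h2⟩ := M.mem_E.1 h
  refine M.mem_E.2 ⟨x, ?_, ?_⟩
  · rw [hf]; exact h2
  · rw [hf, Bool.not_not]; exact h1

theorem g_ep {g : M.X → ℤ} (hg : ∀ i x, g (M.st i x) = g x) (b : Bool) (x : M.X) :
    g (M.ep b x).1.1 = g (M.tb b x) := hg 0 _

theorem ep_inj {x y : M.X} (b : Bool) (h1 : M.ep b x = M.ep b y)
    (h2 : M.ep (!b) x = M.ep (!b) y) : x = y := by
  classical
  have h : ∀ c, M.ep c x = M.ep c y := by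
    cases b <;> intro c <;> cases c <;> assumption
  obtain ⟨g, hg, hs⟩ := M.sep {x, y} x (by simp)
  have e1 := hs x (by simp)
  have e2 := hs y (by simp)
  have a1 : g x = g y := by
    have := congrArg (fun v : M.V => g v.1.1) (h false)
    simp only [M.g_ep hg] at this
    exact this
  have a2 : g (M.θ x) = g (M.θ y) := by
    have := congrArg (fun v : M.V => g v.1.1) (h true)
    simp only [M.g_ep hg] at this
    exact this
  rw [← a1, ← a2, e1] at e2
  by_contra hne
  simp [Ne.symm hne] at e2

theorem nb_inj (u : M.V) : Function.Injective (fun i => M.nb i u) := by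
  intro i j h
  have h1 : M.ed i u = M.ed j u :=
    M.ep_inj u.2 (by rw [M.ep_ed, M.ep_ed]) h
  have h2 := (M.tb u.2).symm.injective h1
  rw [← M.co_st i u.1.1, h2, M.co_st]

theorem nbhd (u : M.V) : {v | (u, v) ∈ M.E} = Set.range (fun i => M.nb i u) := by
  ext v; simp [E]

/-- vertex measure -/
noncomputable def nuV : Measure M.V :=
  (2⁻¹ : ENNReal) • (M.μ.map (M.ep false)) + (2⁻¹ : ENNReal) • (M.μ.map (M.ep true))

instance : IsProbabilityMeasure M.nuV := by
  constructor
  have h : ∀ b, (M.μ.map (M.ep b)) Set.univ = 1 := fun b => by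
    have := Measure.isProbabilityMeasure_map (μ := M.μ) (M.ep_meas b).aemeasurable
    exact measure_univ
  simp [nuV, h, ENNReal.inv_two_add_inv_two]

theorem int_bdd {f : M.X → ℝ} (hf : Measurable f) {K : ℝ} (hb : ∀ x, |f x| ≤ K) :
    Integrable f M.μ :=
  Integrable.of_bound hf.aestronglyMeasurable K (Filter.Eventually.of_forall hb)

theorem int_nuV {F : M.V → ℝ} (hF : Measurable F) {K : ℝ} (hb : ∀ x, |F x| ≤ K) :
    ∫ v, F v ∂M.nuV = 2⁻¹ * (∫ x, F (M.ep false x) ∂M.μ + ∫ x, F (M.ep true x) ∂M.μ) := by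
  have h : ∀ b, Integrable F (M.μ.map (M.ep b)) := fun b => by
    have := Measure.isProbabilityMeasure_map (μ := M.μ) (M.ep_meas b).aemeasurable
    exact Integrable.of_bound hF.aestronglyMeasurable K (Filter.Eventually.of_forall hb)
  rw [nuV, integral_add_measure ((h false).smul_measure (by simp)) ((h true).smul_measure (by simp)),
    integral_smul_measure, integral_smul_measure,
    integral_map (M.ep_meas _).aemeasurable hF.aestronglyMeasurable,
    integral_map (M.ep_meas _).aemeasurable hF.aestronglyMeasurable]
  simp; ring

theorem ae_ep {p : M.V → Prop} (h : ∀ᵐ v ∂M.nuV, p v) (b : Bool) :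
    ∀ᵐ x ∂M.μ, p (M.ep b x) := by
  rw [nuV, ae_add_measure_iff, Measure.ae_ennreal_smul_measure_iff (by simp),
    Measure.ae_ennreal_smul_measure_iff (by simp)] at h
  cases b
  · exact ae_of_ae_map (M.ep_meas _).aemeasurable h.1
  · exact ae_of_ae_map (M.ep_meas _).aemeasurable h.2

theorem star_int {F : M.X → ℝ} (hF : Measurable F) {K : ℝ} (hb : ∀ x, |F x| ≤ K) (b : Bool) :
    ∫ x, ∑ i, F (M.ed i (M.ep b x)) ∂M.μ = d * ∫ x, F x ∂M.μ := by
  have hm : Measurable (fun w => F ((M.tb b).symm w)) := hF.comp (M.tb_symm_meas b)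
  simp only [M.ed_ep']
  have e1 : ∫ x, ∑ i, F ((M.tb b).symm (M.st i (M.tb b x))) ∂M.μ =
      ∫ w, ∑ i, F ((M.tb b).symm (M.st i w)) ∂M.μ := by
    conv_rhs => rw [← (M.tb_mp b).map_eq]
    rw [integral_map (M.tb_meas b).aemeasurable]
    exact (Finset.measurable_sum _ fun i _ => hm.comp (M.st_meas i)).aestronglyMeasurable
  have e2 : ∫ x, F ((M.tb b).symm x) ∂M.μ = ∫ x, F x ∂M.μ := by
    conv_rhs => rw [← (M.tb_symm_mp b).map_eq]
    rw [integral_map (M.tb_symm_meas b).aemeasurable hF.aestronglyMeasurable]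
  rw [e1, ← e2, ← M.avg _ hm ⟨K, fun x => hb _⟩, integral_finsetSum]
  intro i _
  exact M.int_bdd (hm.comp (M.st_meas i)) fun x => hb _

open Classical in
theorem ncard_nb (B : Set M.V) (u : M.V) :
    ((Set.ncard {v ∈ B | (u, v) ∈ M.E} : ℕ) : ℝ) = ∑ i, (if M.nb i u ∈ B then (1 : ℝ) else 0) := by
  have : {v ∈ B | (u, v) ∈ M.E} = ((Finset.univ.filter fun i => M.nb i u ∈ B).image
      (fun i => M.nb i u) : Finset M.V) := by
    ext v
    simp only [E, Set.mem_ofPred_eq, Finset.coe_image, Finset.coe_filter, Finset.mem_univ, true_and,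
      Set.mem_image]
    constructor
    · rintro ⟨h, i, rfl⟩; exact ⟨i, h, rfl⟩
    · rintro ⟨i, h, rfl⟩; exact ⟨h, i, rfl⟩
  rw [this, Set.ncard_coe_finset, Finset.card_image_of_injective _ (M.nb_inj u)]
  simp

open Classical in
theorem mt_formula {A B : Set M.V} (hA : MeasurableSet A) (hB : MeasurableSet B) :
    ∫ u in A, ((Set.ncard {v ∈ B | (u, v) ∈ M.E} : ℕ) : ℝ) ∂M.nuV =
    2⁻¹ * (d * ∫ x, (if M.ep false x ∈ A then (1 : ℝ) else 0) * (if M.ep true x ∈ B then 1 else 0) ∂M.μ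
      + d * ∫ x, (if M.ep true x ∈ A then (1 : ℝ) else 0) * (if M.ep false x ∈ B then 1 else 0) ∂M.μ) := by
  have iA : Measurable (fun u : M.V => if u ∈ A then (1 : ℝ) else 0) :=
    Measurable.ite hA measurable_const measurable_const
  have iB : Measurable (fun u : M.V => if u ∈ B then (1 : ℝ) else 0) :=
    Measurable.ite hB measurable_const measurable_const
  have b01 : ∀ p q : Prop, |(if p then (1 : ℝ) else 0) * (if q then (1 : ℝ) else 0)| ≤ 1 := by
    intro p q; split_ifs <;> simp
  rw [← integral_indicator hA]
  have e : (A.indicator fun u => ((Set.ncard {v ∈ B | (u, v) ∈ M.E} : ℕ) : ℝ)) =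
      fun u => ∑ i, (if u ∈ A then (1 : ℝ) else 0) * (if M.nb i u ∈ B then (1 : ℝ) else 0) := by
    funext u
    rw [Set.indicator_apply, M.ncard_nb, ← Finset.mul_sum]
    split_ifs <;> simp
  rw [e, M.int_nuV (K := ∑ i : Fin d, 1)]
  · have hH : ∀ b, Measurable (fun x => (if M.ep b x ∈ A then (1 : ℝ) else 0) *
        (if M.ep (!b) x ∈ B then (1 : ℝ) else 0)) := fun b =>
      (iA.comp (M.ep_meas b)).mul (iB.comp (M.ep_meas (!b)))
    have k := fun b => M.star_int (hH b) (K := 1) (fun x => b01 _ _) b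
    have k' : ∀ b, ∫ x, ∑ i, (if M.ep b x ∈ A then (1 : ℝ) else 0) *
        (if M.nb i (M.ep b x) ∈ B then (1 : ℝ) else 0) ∂M.μ = d * ∫ x, (if M.ep b x ∈ A then (1 : ℝ) else 0) *
        (if M.ep (!b) x ∈ B then (1 : ℝ) else 0) ∂M.μ := by
      intro b
      rw [← k b]
      congr 1; funext x
      refine Finset.sum_congr rfl fun i _ => ?_
      have := M.ep_ed i (M.ep b x)
      rw [show M.ep b (M.ed i (M.ep b x)) = M.ep b x from this]
      rfl
    rw [k' false, k' true]
    rfl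
  · exact Finset.measurable_sum _ fun i _ => iA.mul (iB.comp (M.nb_meas i))
  · intro u
    refine (Finset.abs_sum_le_sum_abs _ _).trans (Finset.sum_le_sum fun i _ => b01 _ _)

theorem mt {A B : Set M.V} (hA : MeasurableSet A) (hB : MeasurableSet B) :
    ∫ u in A, ((Set.ncard {v ∈ B | (u, v) ∈ M.E} : ℕ) : ℝ) ∂M.nuV =
    ∫ u in B, ((Set.ncard {v ∈ A | (u, v) ∈ M.E} : ℕ) : ℝ) ∂M.nuV := by
  classical
  rw [M.mt_formula hA hB, M.mt_formula hB hA, add_comm]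
  simp only [mul_comm]

end Model

end TreeConstr

namespace TreeConstr
namespace Model

set_option linter.unusedSectionVars false

variable {d : ℕ} [NeZero d] (M : Model d)

/-- the graphing of a model -/
noncomputable def graphing : Graphing where
  V := M.V
  ν := M.nuV
  E := M.E
  E_meas := M.E_meas
  symm := M.E_symm
  irrefl := fun u h => by
    have := M.E_flip h
    cases hb : u.2 <;> simp [hb] at this
  locFin := fun u => by
    rw [M.nbhd]; exact Set.finite_range _
  massTransport := fun A B hA hB => M.mt hA hB

theorem graphing_regular : M.graphing.IsRegular d := by
  suffices h : ∀ u : M.V, Set.ncard {v : M.V | (u, v) ∈ M.E} = d from h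
  intro u
  rw [M.nbhd, ← Set.image_univ, Set.ncard_image_of_injective _ (M.nb_inj u), Set.ncard_univ]
  simp

theorem graphing_bip : M.graphing.MeasurablyBipartite := by
  refine ⟨{u : M.V | u.2 = true}, measurable_snd (measurableSet_singleton true), fun u v h => ?_⟩
  have h1 : v.2 = !u.2 := M.E_flip h
  change u.2 = true ↔ ¬ (v.2 = true)
  rw [h1]; simp

theorem graphing_acyclic : M.graphing.Acyclic := by
  classical
  rintro ⟨k, x, hk, hinj, hE⟩
  change Fin (k + 1) → M.V at x
  have hE' : ∀ i, ∃ e, M.ep (x i).2 e = x i ∧ M.ep (!(x i).2) e = x (i + 1) :=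
    fun i => M.mem_E.1 (hE i)
  choose e he1 he2 using hE'
  obtain ⟨g, hg, hs⟩ := M.sep (Finset.univ.image e) (e 0)
    (Finset.mem_image_of_mem _ (Finset.mem_univ _))
  have hs' : ∀ i, g (M.θ (e i)) - g (e i) = if e i = e 0 then 1 else 0 := fun i =>
    hs _ (Finset.mem_image_of_mem _ (Finset.mem_univ _))
  have hne : ∀ i, i ≠ 0 → e i ≠ e 0 := by
    intro i hi h
    have a1 := he1 i
    have a2 := he2 i
    rw [h] at a1 a2
    by_cases hb : (x i).2 = (x 0).2
    · rw [hb, he1 0] at a1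
      exact hi (hinj a1).symm
    · have hb' : (x i).2 = !(x 0).2 := by
        cases h1 : (x i).2 <;> cases h2 : (x 0).2 <;> simp_all
      rw [hb', he2 0] at a1
      rw [hb', Bool.not_not, he1 0] at a2
      have b1 : (0 : Fin (k + 1)) + 1 = i := hinj a1
      have b2 : (0 : Fin (k + 1)) = i + 1 := hinj a2
      rw [← b1] at b2
      have := congrArg Fin.val b2
      obtain ⟨k, rfl⟩ : ∃ j, k = j + 2 := ⟨k - 2, by omega⟩
      simp [Fin.val_add] at this
      rw [Nat.mod_eq_of_lt (by omega)] at this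
      omega
  have hP1 : ∀ i, g (x i).1.1 = g (M.tb (x i).2 (e i)) := fun i => by
    conv_lhs => rw [← he1 i]
    exact M.g_ep hg _ _
  have hP2 : ∀ i, g (x (i + 1)).1.1 = g (M.tb (!(x i).2) (e i)) := fun i => by
    conv_lhs => rw [← he2 i]
    exact M.g_ep hg _ _
  have hD : ∀ i, g (x (i + 1)).1.1 - g (x i).1.1 =
      (if (x i).2 then -1 else 1) * (if e i = e 0 then 1 else 0) := by
    intro i
    rw [hP2, hP1, ← hs' i]
    cases (x i).2
    · simp [tb]
    · simp [tb]
  have hsum : ∑ i, (g (x (i + 1)).1.1 - g (x i).1.1) = 0 := by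
    rw [Finset.sum_sub_distrib, sub_eq_zero]
    exact Equiv.sum_comp (Equiv.addRight (1 : Fin (k + 1))) (fun i => g (x i).1.1)
  rw [Finset.sum_eq_single 0 (fun i _ hi => by rw [hD, if_neg (hne i hi), mul_zero])
    (by simp), hD] at hsum
  cases h : (x 0).2 <;> simp [h] at hsum

open Classical in
/-- the orientation function -/
noncomputable def ori {m : ℕ} (s : Fin m → Equiv.Perm M.V) (x : M.X) : ℝ :=
  if ∃ j, s j (M.ep false x) = M.ep true x then 1 else -1

theorem ori_meas {m : ℕ} {s : Fin m → Equiv.Perm M.V} (hs : ∀ j, Measurable (s j)) :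
    Measurable (M.ori s) := by
  refine Measurable.ite ?_ measurable_const measurable_const
  have : {x | ∃ j, s j (M.ep false x) = M.ep true x} =
      ⋃ j, {x | s j (M.ep false x) = M.ep true x} := by ext; simp
  rw [this]
  exact MeasurableSet.iUnion fun j =>
    measurableSet_eq_fun ((hs j).comp (M.ep_meas false)) (M.ep_meas true)

theorem ori_sum {m : ℕ} (hd : d = 2 * m) (s : Fin m → Equiv.Perm M.V) (u : M.V)
    (hu : {v | (u, v) ∈ M.E} = ⋃ j, {s j u, (s j)⁻¹ u}) :
    ∑ i, M.ori s (M.ed i u) = 0 := by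
  classical
  let T : Fin m × Bool → M.V := fun q => if q.2 then s q.1 u else (s q.1)⁻¹ u
  rw [M.nbhd] at hu
  have hT : ∀ q, ∃ i, M.nb i u = T q := by
    intro q
    have : T q ∈ Set.range (fun i => M.nb i u) := by
      rw [hu]
      refine Set.mem_iUnion.2 ⟨q.1, ?_⟩
      simp only [T]
      split_ifs <;> simp
    exact this
  choose π hπ using hT
  have hsurj : Function.Surjective π := by
    intro i
    have : M.nb i u ∈ ⋃ j, {s j u, (s j)⁻¹ u} := by rw [← hu]; exact ⟨i, rfl⟩
    obtain ⟨j, hj⟩ := Set.mem_iUnion.1 this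
    rcases hj with hj | hj
    · exact ⟨(j, true), M.nb_inj u ((hπ _).trans (by simpa [T] using hj.symm))⟩
    · exact ⟨(j, false), M.nb_inj u ((hπ _).trans (by simpa [T] using hj.symm))⟩
  have hbij : Function.Bijective π :=
    (Fintype.bijective_iff_surjective_and_card π).2 ⟨hsurj, by simp [hd, mul_comm]⟩
  have hTi : Function.Injective T := by
    intro q q' h
    apply hbij.1
    apply M.nb_inj u
    simp only [hπ, h]
  have hval : ∀ q, M.ori s (M.ed (π q) u) = if q.2 = !u.2 then 1 else -1 := by
    intro q
    have a1 : M.ep u.2 (M.ed (π q) u) = u := M.ep_ed _ _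
    have a2 : M.ep (!u.2) (M.ed (π q) u) = T q := hπ q
    unfold ori
    refine if_congr ?_ rfl rfl
    cases hb : u.2 with
    | false =>
      rw [hb] at a1 a2
      simp only [Bool.not_false] at a2 ⊢
      rw [a1, a2]
      constructor
      · rintro ⟨j, hj⟩
        have : T (j, true) = T q := by simpa [T] using hj
        rw [← hTi this]
      · intro h
        exact ⟨q.1, by simp [T, h]⟩
    | true =>
      rw [hb] at a1 a2
      simp only [Bool.not_true] at a2 ⊢
      rw [a1, a2]
      constructor
      · rintro ⟨j, hj⟩
        have : T (j, false) = T q := by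
          simp only [T, Bool.false_eq_true, if_false]
          rw [Equiv.Perm.inv_eq_iff_eq]; exact hj.symm
        rw [← hTi this]
      · intro h
        exact ⟨q.1, by simp [T, h]⟩
  rw [← Function.Bijective.sum_comp hbij (fun i => M.ori s (M.ed i u))]
  simp only [hval]
  rw [Fintype.sum_prod_type]
  refine Finset.sum_eq_zero fun j _ => ?_
  cases u.2 <;> simp

theorem no_schreier {m : ℕ} (hd : d = 2 * m) (s : Fin m → Equiv.Perm M.V)
    (hs : ∀ j, Measurable (s j))
    (h : ∀ᵐ u ∂M.nuV, {v | (u, v) ∈ M.E} = ⋃ j, {s j u, (s j)⁻¹ u}) : False := by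
  have h0 : ∀ᵐ u ∂M.nuV, ∑ i, M.ori s (M.ed i u) = 0 := by
    filter_upwards [h] with u hu using M.ori_sum hd s u hu
  have h1 := M.ae_ep h0 false
  have h2 := M.ae_ep h0 true
  have h3 := (M.tb_symm_mp true).quasiMeasurePreserving.ae h2
  simp only [M.ed_ep', Equiv.apply_symm_apply] at h1 h3
  have h4 := M.circ (M.ori s) (M.ori_meas hs) (fun x => by unfold ori; split_ifs <;> simp) h1 h3
  obtain ⟨x, hx⟩ := h4.exists
  unfold ori at hx
  split_ifs at hx <;> norm_num at hx

end Model
end TreeConstr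


/-- For every even `d = 2m ≥ 2` there is a `d`-regular measurably bipartite treeing `T`
which is not the Schreier graphing of a pmp action of the free group `F_{d/2}`:
there is no action `σ` of `FreeGroup (Fin m)` by Borel measure-preserving bijections
which is essentially free and such that for a.e. `x` the set of neighbours of `x`
equals `{S₁x, S₁⁻¹x, …, S_m x, S_m⁻¹x}` where `Sᵢ = σ (FreeGroup.of i)`. -/
theorem exists_treeing_not_schreier_of_free_group :
    ∀ m : ℕ, 1 ≤ m → ∃ T : Graphing,
      T.IsRegular (2 * m) ∧ T.Acyclic ∧ T.MeasurablyBipartite ∧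
      ¬ ∃ σ : FreeGroup (Fin m) →* Equiv.Perm T.V,
          (∀ i : Fin m, Measurable (σ (FreeGroup.of i) : T.V → T.V)) ∧
          (∀ i : Fin m, Measurable ((σ (FreeGroup.of i))⁻¹ : Equiv.Perm T.V) ) ∧
          (∀ i : Fin m, MeasureTheory.MeasurePreserving (σ (FreeGroup.of i)) T.ν T.ν) ∧
          (∀ᵐ x ∂T.ν, ∀ w : FreeGroup (Fin m), w ≠ 1 → σ w x ≠ x) ∧
          (∀ᵐ x ∂T.ν, {y : T.V | (x, y) ∈ T.E} =
            ⋃ i : Fin m, {σ (FreeGroup.of i) x, (σ (FreeGroup.of i))⁻¹ x}) := by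
  intro m hm
  have : NeZero (2 * m) := ⟨by omega⟩
  obtain ⟨M⟩ := TreeConstr.exists_model hm
  refine ⟨M.graphing, M.graphing_regular, M.graphing_acyclic, M.graphing_bip, ?_⟩
  rintro ⟨σ, h1, -, -, -, h5⟩
  exact M.no_schreier rfl (fun i => σ (FreeGroup.of i)) h1 h5
end

section
/- Let G be a graphing with vertex space (V, ν) and all degrees at most d, let f be a circulation in L¹(E(G)), and let g : V → ℝ be a bounded Borel function. Then ∫_V ∑_y f(x,y)·(g(x) − g(y)) dν(x) = 0 (the inner sum is finite since degrees are finite, and the integrand is integrable since f ∈ L¹ and g is bounded). -/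
open MeasureTheory

open MeasureTheory ProbabilityTheory

/-- The set of points with at least `k` points in the section of `S` is Borel. -/
theorem measurableSet_le_ncard_section {V : Type} [MeasurableSpace V] [StandardBorelSpace V]
    (S : Set (V × V)) (hS : MeasurableSet S) (d : ℕ)
    (hfin : ∀ x, {y | (x, y) ∈ S}.Finite) (hd : ∀ x, {y | (x, y) ∈ S}.ncard ≤ d) (j : ℕ) :
    ∀ k, d + 1 ≤ k + j → MeasurableSet {x | k ≤ {y | (x, y) ∈ S}.ncard} := by
  induction j with
  | zero =>
    intro k hk
    have : {x | k ≤ {y | (x, y) ∈ S}.ncard} = ∅ := by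
      ext x
      have := hd x
      simp only [Set.mem_ofPred_eq, Set.mem_empty_iff_false, iff_false]
      omega
    rw [this]; exact MeasurableSet.empty
  | succ j ih =>
    intro k hk
    have h1 := ih (k + 1) (by omega)
    let φ := embeddingReal V
    have hφ : Measurable φ := measurable_embeddingReal V
    have hφi : Function.Injective φ := (measurableEmbedding_embeddingReal V).injective
    let T : Set (V × (Fin k → V)) :=
      {p | (∀ i j, i < j → φ (p.2 i) < φ (p.2 j)) ∧ (∀ i, (p.1, p.2 i) ∈ S) ∧
        ¬ (k + 1 ≤ {y | (p.1, y) ∈ S}.ncard)}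
    have hT : MeasurableSet T := by
      have a1 : MeasurableSet {p : V × (Fin k → V) | ∀ i j, i < j → φ (p.2 i) < φ (p.2 j)} := by
        simp only [Set.ofPred_forall]
        refine MeasurableSet.iInter fun i => MeasurableSet.iInter fun j =>
          MeasurableSet.iInter fun _ => measurableSet_lt ?_ ?_
        · exact hφ.comp ((measurable_pi_apply i).comp measurable_snd)
        · exact hφ.comp ((measurable_pi_apply j).comp measurable_snd)
      have a2 : MeasurableSet {p : V × (Fin k → V) | ∀ i, (p.1, p.2 i) ∈ S} := by
        simp only [Set.ofPred_forall]
        refine MeasurableSet.iInter fun i => ?_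
        exact (measurable_fst.prodMk ((measurable_pi_apply i).comp measurable_snd)) hS
      have a3 : MeasurableSet {p : V × (Fin k → V) | ¬ (k + 1 ≤ {y | (p.1, y) ∈ S}.ncard)} :=
        measurable_fst h1.compl
      exact a1.inter (a2.inter a3)
    have hrange : ∀ p ∈ T, Set.range p.2 = {y | (p.1, y) ∈ S} := by
      rintro p ⟨hm, hs, hk⟩
      have hsm : StrictMono (fun i => φ (p.2 i)) := fun i j h => hm i j h
      have hinj : Function.Injective p.2 := fun i j h => hsm.injective (by simp [h])
      apply Set.eq_of_subset_of_ncard_le _ _ (hfin p.1)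
      · rintro _ ⟨i, rfl⟩; exact hs i
      · rw [← Set.image_univ, Set.ncard_image_of_injective _ hinj, Set.ncard_univ, Nat.card_fin]
        omega
    have hinj : Set.InjOn Prod.fst T := by
      rintro ⟨x, t⟩ ht ⟨x', t'⟩ ht' (rfl : x = x')
      have e : Set.range t = Set.range t' := (hrange _ ht).trans (hrange _ ht').symm
      have m1 : StrictMono (φ ∘ t) := fun i j h => ht.1 i j h
      have m2 : StrictMono (φ ∘ t') := fun i j h => ht'.1 i j h
      have e2 : φ ∘ t = φ ∘ t' := by
        apply (StrictMono.range_inj m1 m2).1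
        rw [Set.range_comp, Set.range_comp, e]
      have : t = t' := hφi.comp_left e2
      rw [this]
    have hTm := hT.image_of_measurable_injOn measurable_fst hinj
    have : {x | k ≤ {y | (x, y) ∈ S}.ncard} =
        {x | k + 1 ≤ {y | (x, y) ∈ S}.ncard} ∪ Prod.fst '' T := by
      ext x
      constructor
      · intro hx
        by_cases hx1 : k + 1 ≤ {y | (x, y) ∈ S}.ncard
        · exact Or.inl hx1
        right
        have hxk : {y | (x, y) ∈ S}.ncard = k := by
          have : k ≤ {y | (x, y) ∈ S}.ncard := hx
          omega
        let F : Finset ℝ := (hfin x).toFinset.map ⟨φ, hφi⟩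
        have hF : F.card = k := by
          rw [Finset.card_map, ← Set.ncard_eq_toFinset_card _ (hfin x), hxk]
        have hmem : ∀ i, ∃ y, (x, y) ∈ S ∧ φ y = F.orderEmbOfFin hF i := by
          intro i
          obtain ⟨y, hy, hyi⟩ := Finset.mem_map.1 (F.orderEmbOfFin_mem hF i)
          exact ⟨y, (hfin x).mem_toFinset.1 hy, hyi⟩
        choose t ht1 ht2 using hmem
        refine ⟨(x, t), ⟨?_, ht1, hx1⟩, rfl⟩
        intro i j h
        simp only [ht2]
        exact (F.orderEmbOfFin hF).strictMono h
      · rintro (h | ⟨p, hp, rfl⟩)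
        · exact (Nat.le_succ k).trans h
        · have hsm : StrictMono (fun i => φ (p.2 i)) := fun i j h => hp.1 i j h
          have hinj : Function.Injective p.2 := fun i j h => hsm.injective (by simp [h])
          have e := hrange p hp
          show k ≤ {y | (p.1, y) ∈ S}.ncard
          rw [← e, ← Set.image_univ, Set.ncard_image_of_injective _ hinj, Set.ncard_univ,
            Nat.card_fin]
    rw [this]
    exact h1.union hTm

theorem measurable_ncard_section {V : Type} [MeasurableSpace V] [StandardBorelSpace V]
    (S : Set (V × V)) (hS : MeasurableSet S) (d : ℕ)
    (hfin : ∀ x, {y | (x, y) ∈ S}.Finite) (hd : ∀ x, {y | (x, y) ∈ S}.ncard ≤ d) :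
    Measurable (fun x => {y | (x, y) ∈ S}.ncard) := by
  refine measurable_of_Ici fun k => ?_
  exact measurableSet_le_ncard_section S hS d hfin hd (d + 1) k (by omega)

namespace Graphing

theorem count_section (G : Graphing) (x : G.V) {B : Set G.V} (hB : MeasurableSet B) :
    (Measure.count.restrict {y | (x, y) ∈ G.E}) B =
      ((Set.ncard {y ∈ B | (x, y) ∈ G.E} : ℕ) : ENNReal) := by
  have hfin : {y ∈ B | (x, y) ∈ G.E}.Finite := (G.locFin x).subset fun y hy => hy.2
  rw [Measure.restrict_apply hB, Set.ncard_eq_toFinset_card _ hfin,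
    ← Measure.count_apply_finite _ hfin]
  rfl

/-- The neighbour-counting kernel. -/
noncomputable def nbrKernel (G : Graphing) (d : ℕ) (hdeg : ∀ x : G.V, G.deg x ≤ d) :
    Kernel G.V G.V where
  toFun x := Measure.count.restrict {y | (x, y) ∈ G.E}
  measurable' := by
    refine Measure.measurable_of_measurable_coe _ fun B hB => ?_
    simp only [G.count_section _ hB]
    have hm := measurable_ncard_section ({p : G.V × G.V | p.2 ∈ B ∧ p ∈ G.E})
      ((measurable_snd hB).inter G.E_meas) d
      (fun x => (G.locFin x).subset fun y hy => hy.2)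
      (fun x => (Set.ncard_le_ncard (fun y hy => hy.2) (G.locFin x)).trans (hdeg x))
    exact (Measurable.of_discrete (f := fun n : ℕ => (n : ENNReal))).comp hm

theorem nbrKernel_apply (G : Graphing) (d : ℕ) (hdeg : ∀ x : G.V, G.deg x ≤ d) (x : G.V) :
    G.nbrKernel d hdeg x = Measure.count.restrict {y | (x, y) ∈ G.E} := rfl

instance (G : Graphing) (d : ℕ) (hdeg : ∀ x : G.V, G.deg x ≤ d) :
    IsFiniteKernel (G.nbrKernel d hdeg) := by
  refine ⟨⟨d, ENNReal.natCast_lt_top d, fun x => ?_⟩⟩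
  rw [nbrKernel_apply, G.count_section x MeasurableSet.univ]
  have := hdeg x
  simp only [deg] at this
  simpa using this

theorem integrable_nbrKernel (G : Graphing) (d : ℕ) (hdeg : ∀ x : G.V, G.deg x ≤ d) (x : G.V)
    (h : G.V → ℝ) : Integrable h (G.nbrKernel d hdeg x) := by
  rw [nbrKernel_apply, ← (G.locFin x).coe_toFinset]
  change IntegrableOn h _ _
  rw [← Set.biUnion_of_singleton ((G.locFin x).toFinset : Set G.V), integrableOn_finite_biUnion (Finset.finite_toSet _)]
  intro y _
  exact integrableOn_singleton (by simp) (by rw [Measure.count_singleton]; simp)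

theorem integral_nbrKernel (G : Graphing) (d : ℕ) (hdeg : ∀ x : G.V, G.deg x ≤ d) (x : G.V)
    (h : G.V → ℝ) (hh : ∀ y, (x, y) ∉ G.E → h y = 0) :
    ∫ y, h y ∂(G.nbrKernel d hdeg x) = ∑ᶠ y, h y := by
  have hs : Function.support h ⊆ ((G.locFin x).toFinset : Set G.V) := by
    intro y hy
    by_contra hc
    exact hy (hh y (by simpa using hc))
  rw [finsum_eq_sum_of_support_subset _ hs, nbrKernel_apply]
  conv_lhs => rw [← (G.locFin x).coe_toFinset]
  rw [setIntegral_finset]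
  · simp [Measure.real]
  · have := G.integrable_nbrKernel d hdeg x h
    rwa [nbrKernel_apply, ← (G.locFin x).coe_toFinset] at this

theorem swap_compProd (G : Graphing) (d : ℕ) (hdeg : ∀ x : G.V, G.deg x ≤ d) :
    (G.ν ⊗ₘ G.nbrKernel d hdeg).map Prod.swap = G.ν ⊗ₘ G.nbrKernel d hdeg := by
  have key : ∀ A B : Set G.V, MeasurableSet A → MeasurableSet B →
      (G.ν ⊗ₘ G.nbrKernel d hdeg) (A ×ˢ B) = ENNReal.ofReal
        (∫ x in A, ((Set.ncard {y ∈ B | (x, y) ∈ G.E} : ℝ)) ∂G.ν) := by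
    intro A B hA hB
    rw [Measure.compProd_apply_prod hA hB]
    have e : ∀ x, ((Set.ncard {y ∈ B | (x, y) ∈ G.E} : ℝ)) =
        (G.nbrKernel d hdeg x B).toReal := by
      intro x
      rw [nbrKernel_apply, G.count_section x hB]
      simp
    simp only [e]
    rw [integral_toReal (Kernel.measurable_coe _ hB).aemeasurable
      (Filter.Eventually.of_forall fun x => measure_lt_top _ _), ENNReal.ofReal_toReal]
    rw [← Measure.compProd_apply_prod hA hB]
    exact measure_ne_top _ _
  refine Measure.ext_prod fun {A B} hA hB => ?_
  rw [Measure.map_apply measurable_swap (hA.prod hB), Set.preimage_swap_prod,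
    key _ _ hB hA, key _ _ hA hB, G.massTransport A B hA hB]

end Graphing

/-- Lovász' lemma on circulations and potentials: for a graphing `G` of degree at most
`d`, a circulation `f ∈ L¹(E(G))` and a bounded Borel function `g : V → ℝ`,
`∫ ∑_y f(x,y)·(g(x) − g(y)) dν(x) = 0`. -/
theorem circulation_potential_orthogonal
    (d : ℕ) (G : Graphing) (hdeg : ∀ x : G.V, G.deg x ≤ d)
    (f : G.V × G.V → ℝ) (hf : G.IsCirculation f)
    (hL1 : MeasureTheory.Integrable (fun x : G.V => ∑ᶠ y : G.V, |f (x, y)|) G.ν)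
    (g : G.V → ℝ) (hg : Measurable g) (C : ℝ) (hbd : ∀ x : G.V, |g x| ≤ C) :
    ∫ x : G.V, (∑ᶠ y : G.V, f (x, y) * (g x - g y)) ∂G.ν = 0 := by
  obtain ⟨hfm, hanti, hsupp, hsum⟩ := hf
  have hfI : Integrable f (G.ν ⊗ₘ G.nbrKernel d hdeg) := by
    rw [Measure.integrable_compProd_iff hfm.aestronglyMeasurable]
    refine ⟨Filter.Eventually.of_forall fun x => G.integrable_nbrKernel d hdeg x _, ?_⟩
    convert hL1 using 2 with x
    rw [G.integral_nbrKernel d hdeg x _ (fun y hy => by simp [hsupp x y hy])]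
    rfl
  have hI1 : Integrable (fun p : G.V × G.V => f p * g p.1) (G.ν ⊗ₘ G.nbrKernel d hdeg) :=
    hfI.mul_bdd (c := C) (hg.comp measurable_fst).aestronglyMeasurable
      (Filter.Eventually.of_forall fun p => hbd p.1)
  have hI2 : Integrable (fun p : G.V × G.V => f p * g p.2) (G.ν ⊗ₘ G.nbrKernel d hdeg) :=
    hfI.mul_bdd (c := C) (hg.comp measurable_snd).aestronglyMeasurable
      (Filter.Eventually.of_forall fun p => hbd p.2)
  have h1 : ∫ p, f p * g p.1 ∂(G.ν ⊗ₘ G.nbrKernel d hdeg) = 0 := by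
    rw [Measure.integral_compProd hI1]
    have : ∀ x, ∫ y, f (x, y) * g x ∂(G.nbrKernel d hdeg x) = 0 := by
      intro x
      rw [integral_mul_const, G.integral_nbrKernel d hdeg x _ (hsupp x), hsum x, zero_mul]
    simp [this]
  have h2 : ∫ p, f p * g p.2 ∂(G.ν ⊗ₘ G.nbrKernel d hdeg) = 0 := by
    rw [← G.swap_compProd d hdeg, integral_map measurable_swap.aemeasurable
      (by exact (hfm.mul (hg.comp measurable_snd)).aestronglyMeasurable)]
    have : ∀ p : G.V × G.V, f p.swap * g p.swap.2 = - (f p * g p.1) := by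
      rintro ⟨x, y⟩
      simp only [Prod.swap_prod_mk]
      rw [hanti y x]; ring
    simp only [this]
    rw [integral_neg, h1, neg_zero]
  have h3 : ∫ p, (f p * (g p.1 - g p.2)) ∂(G.ν ⊗ₘ G.nbrKernel d hdeg) = 0 := by
    simp only [mul_sub]
    rw [integral_sub hI1 hI2, h1, h2, sub_zero]
  have hI3 : Integrable (fun p : G.V × G.V => f p * (g p.1 - g p.2))
      (G.ν ⊗ₘ G.nbrKernel d hdeg) := by
    simp only [mul_sub]
    exact hI1.sub hI2
  rw [Measure.integral_compProd hI3] at h3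
  rw [← h3]
  refine integral_congr_ae (Filter.Eventually.of_forall fun x => ?_)
  exact (G.integral_nbrKernel d hdeg x _ (fun y hy => by simp [hsupp x y hy])).symm
end

section
/- Let G be a graphing with vertex space (V, ν) and all degrees at most d. Assume that for every Borel orientation O of G and every ε > 0 there exists a bounded Borel function g : V → ℝ such that g(x) − g(y) ∈ {−1, 0, 1} for every edge (x,y) ∈ E, and the symmetric Borel set S of edges violating the orientation, S = {(x,y) ∈ E : ((x,y) ∈ O and g(y) ≠ g(x)+1) or ((y,x) ∈ O and g(x) ≠ g(y)+1)}, satisfies μ(S) = (1/2)∫_V #{y : (x,y) ∈ S} dν(x) ≤ ε. Then every circulation f ∈ L¹(E(G)) is zero almost everywhere, i.e. ∫_V ∑_y |f(x,y)| dν(x) = 0. -/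
open MeasureTheory

/-- A Borel orientation of a graphing: a Borel subset of `E` containing exactly one of
`(x, y)`, `(y, x)` for each edge. -/
def Graphing.IsOrientation (G : Graphing) (O : Set (G.V × G.V)) : Prop :=
  O ⊆ G.E ∧ MeasurableSet O ∧ ∀ x y : G.V, (x, y) ∈ G.E → ((x, y) ∈ O ↔ (y, x) ∉ O)

open scoped ENNReal ProbabilityTheory

/-- The section of a relation. -/
def GSec {V : Type} (E : Set (V × V)) (x : V) : Set V := {y | (x, y) ∈ E}

/-- If all sections of a Borel set have size at most `d + 1`, then the set of points with section
of size exactly `d + 1` is Borel (Lusin-Souslin). -/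
lemma measurableSet_sec_max {V : Type} [MeasurableSpace V] [StandardBorelSpace V] (d : ℕ)
    (E : Set (V × V)) (hE : MeasurableSet E) (hfin : ∀ x, (GSec E x).Finite)
    (hd : ∀ x, (GSec E x).ncard ≤ d) : MeasurableSet {x | (GSec E x).ncard = d} := by
  classical
  let e : V → ℝ := embeddingReal V
  have he : MeasurableEmbedding e := measurableEmbedding_embeddingReal V
  let T : Set (V × (Fin d → V)) :=
    {p | (∀ i, (p.1, p.2 i) ∈ E) ∧ ∀ i j, i < j → e (p.2 i) < e (p.2 j)}
  have hT : MeasurableSet T := by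
    have h1 : MeasurableSet {p : V × (Fin d → V) | ∀ i, (p.1, p.2 i) ∈ E} := by
      rw [Set.ofPred_forall]
      refine MeasurableSet.iInter fun i => ?_
      have : Measurable fun p : V × (Fin d → V) => (p.1, p.2 i) := by fun_prop
      exact this hE
    have h2 : MeasurableSet {p : V × (Fin d → V) | ∀ i j, i < j → e (p.2 i) < e (p.2 j)} := by
      simp only [Set.ofPred_forall]
      refine MeasurableSet.iInter fun i => MeasurableSet.iInter fun j =>
        MeasurableSet.iInter fun _ => ?_
      have hm := he.measurable
      exact measurableSet_lt (by fun_prop) (by fun_prop)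
    exact h1.inter h2
  have hrange : ∀ p ∈ T, Set.range p.2 = GSec E p.1 := by
    rintro ⟨x, v⟩ ⟨h1, h2⟩
    have hv : Function.Injective v := by
      have : StrictMono (e ∘ v) := fun i j hij => h2 i j hij
      exact this.injective.of_comp
    apply Set.eq_of_subset_of_ncard_le _ _ (hfin x)
    · rintro _ ⟨i, rfl⟩; exact h1 i
    · have : (Set.range v).ncard = d := by
        rw [← Nat.card_coe_set_eq, Nat.card_range_of_injective hv, Nat.card_fin]
      simpa [this] using hd x
  have hinj : Set.InjOn (Prod.fst : V × (Fin d → V) → V) T := by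
    intro p hp q hq hpq
    refine Prod.ext hpq ?_
    have h1 : StrictMono (e ∘ p.2) := fun i j hij => hp.2 i j hij
    have h2 : StrictMono (e ∘ q.2) := fun i j hij => hq.2 i j hij
    have : e ∘ p.2 = e ∘ q.2 := by
      rw [← StrictMono.range_inj h1 h2, Set.range_comp, Set.range_comp, hrange p hp, hrange q hq, hpq]
    exact he.injective.comp_left this
  have : {x | (GSec E x).ncard = d} = Prod.fst '' T := by
    ext x
    constructor
    · intro hx
      have hx : (GSec E x).ncard = d := hx
      let s : Finset ℝ := ((hfin x).toFinset).image e
      have hs : s.card = d := by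
        rw [Finset.card_image_of_injective _ he.injective, ← hx, Set.ncard_eq_toFinset_card _ (hfin x)]
      have hmem : ∀ i, ∃ y, y ∈ GSec E x ∧ e y = s.orderEmbOfFin hs i := by
        intro i
        have := s.orderEmbOfFin_mem hs i
        obtain ⟨y, hy, hy2⟩ := Finset.mem_image.mp this
        exact ⟨y, (hfin x).mem_toFinset.mp hy, hy2⟩
      choose v hv1 hv2 using hmem
      refine ⟨(x, v), ⟨hv1, fun i j hij => ?_⟩, rfl⟩
      simp only [hv2]
      exact (s.orderEmbOfFin hs).strictMono hij
    · rintro ⟨p, hp, rfl⟩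
      have hv : Function.Injective p.2 := by
        have : StrictMono (e ∘ p.2) := fun i j hij => hp.2 i j hij
        exact this.injective.of_comp
      show (GSec E p.1).ncard = d
      rw [← hrange p hp, ← Nat.card_coe_set_eq, Nat.card_range_of_injective hv, Nat.card_fin]
  rw [this]
  exact hT.image_of_measurable_injOn measurable_fst hinj

lemma measurable_sec_ncard {V : Type} [MeasurableSpace V] [StandardBorelSpace V] (d : ℕ) :
    ∀ (E : Set (V × V)), MeasurableSet E → (∀ x, (GSec E x).Finite) →
    (∀ x, (GSec E x).ncard ≤ d) → Measurable fun x => (GSec E x).ncard := by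
  classical
  induction d with
  | zero =>
    intro E _ _ hd
    have : (fun x => (GSec E x).ncard) = fun _ => 0 := funext fun x => Nat.le_zero.mp (hd x)
    rw [this]; exact measurable_const
  | succ d ih =>
    intro E hE hfin hd
    have hA := measurableSet_sec_max (d + 1) E hE hfin hd
    set A := {x | (GSec E x).ncard = d + 1} with hAdef
    have hsec : ∀ x, GSec (E ∩ Prod.fst ⁻¹' Aᶜ) x = if x ∈ A then ∅ else GSec E x := by
      intro x
      ext y
      by_cases hx : x ∈ A <;> simp [GSec, hx]
    have hm := ih (E ∩ Prod.fst ⁻¹' Aᶜ) (hE.inter (measurable_fst hA.compl))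
      (fun x => (hfin x).subset fun y hy => hy.1) (by
        intro x
        rw [hsec]
        split_ifs with hx
        · simp
        · have := hd x
          have hx : (GSec E x).ncard ≠ d + 1 := hx
          omega)
    have : (fun x => (GSec E x).ncard) = fun x => if x ∈ A then d + 1 else
        (GSec (E ∩ Prod.fst ⁻¹' Aᶜ) x).ncard := by
      funext x
      rw [hsec]
      split_ifs with hx
      · exact hx
      · rfl
    rw [this]
    exact Measurable.ite hA measurable_const hm

lemma Graphing.fiber_count (G : Graphing) (x : G.V) (B : Set G.V) (hB : MeasurableSet B) :
    (Measure.count.restrict (GSec G.E x)) B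
      = ((GSec (G.E ∩ Prod.snd ⁻¹' B) x).ncard : ℝ≥0∞) := by
  have hfin : (GSec (G.E ∩ Prod.snd ⁻¹' B) x).Finite := (G.locFin x).subset fun y hy => hy.1
  have : B ∩ GSec G.E x = GSec (G.E ∩ Prod.snd ⁻¹' B) x := by
    ext y; simp [GSec, and_comm]
  rw [Measure.restrict_apply hB, this, Measure.count_apply_finite _ hfin,
    Set.ncard_eq_toFinset_card _ hfin]

/-- The kernel of counting measures on neighbourhoods. -/
noncomputable def Graphing.ker (G : Graphing) (d : ℕ) (hdeg : ∀ x : G.V, G.deg x ≤ d) :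
    ProbabilityTheory.Kernel G.V G.V where
  toFun x := Measure.count.restrict (GSec G.E x)
  measurable' := by
    refine Measure.measurable_of_measurable_coe _ fun B hB => ?_
    simp_rw [G.fiber_count _ B hB]
    have := measurable_sec_ncard d (G.E ∩ Prod.snd ⁻¹' B) (G.E_meas.inter (measurable_snd hB))
      (fun x => (G.locFin x).subset fun y hy => hy.1)
      (fun x => (Set.ncard_le_ncard (fun y hy => hy.1) (G.locFin x)).trans (hdeg x))
    exact (measurable_from_top (f := fun n : ℕ => (n : ℝ≥0∞))).comp this

lemma Graphing.ker_apply (G : Graphing) (d : ℕ) (hdeg : ∀ x : G.V, G.deg x ≤ d) (x : G.V) :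
    G.ker d hdeg x = Measure.count.restrict (GSec G.E x) := rfl

instance Graphing.ker_finite (G : Graphing) (d : ℕ) (hdeg : ∀ x : G.V, G.deg x ≤ d) :
    ProbabilityTheory.IsFiniteKernel (G.ker d hdeg) := by
  refine ⟨d, by simp, fun x => ?_⟩
  rw [ker_apply, G.fiber_count _ _ MeasurableSet.univ]
  have := (Set.ncard_le_ncard (s := GSec (G.E ∩ Prod.snd ⁻¹' Set.univ) x)
    (fun y hy => hy.1) (G.locFin x)).trans (hdeg x)
  exact_mod_cast this

lemma Graphing.ker_integrable (G : Graphing) (d : ℕ) (hdeg : ∀ x : G.V, G.deg x ≤ d) (x : G.V)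
    (F : G.V → ℝ) : Integrable F (G.ker d hdeg x) := by
  rw [ker_apply]
  change IntegrableOn F _ _
  have hfin : (GSec G.E x).Finite := G.locFin x
  rw [← Set.biUnion_of_singleton (GSec G.E x), integrableOn_finite_biUnion hfin]
  intro y _
  exact integrableOn_singleton (by simp) (by simp)

lemma Graphing.ker_integral (G : Graphing) (d : ℕ) (hdeg : ∀ x : G.V, G.deg x ≤ d) (x : G.V)
    (F : G.V → ℝ) (hF : ∀ y, (x, y) ∉ G.E → F y = 0) :
    ∫ y, F y ∂(G.ker d hdeg x) = ∑ᶠ y, F y := by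
  have hi := G.ker_integrable d hdeg x F
  rw [ker_apply] at hi ⊢
  have hfin : (GSec G.E x).Finite := G.locFin x
  rw [← hfin.coe_toFinset] at hi ⊢
  rw [setIntegral_finset _ _, finsum_eq_sum_of_support_subset (s := hfin.toFinset)]
  · simp [measureReal_def]
  rotate_left
  · exact hi
  · intro y hy
    rw [hfin.coe_toFinset]
    by_contra hc
    exact hy (hF y hc)

/-- The (ordered) edge measure. -/
noncomputable def Graphing.emeas (G : Graphing) (d : ℕ) (hdeg : ∀ x : G.V, G.deg x ≤ d) :
    Measure (G.V × G.V) := G.ν ⊗ₘ (G.ker d hdeg)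

instance Graphing.emeas_finite (G : Graphing) (d : ℕ) (hdeg : ∀ x : G.V, G.deg x ≤ d) :
    IsFiniteMeasure (G.emeas d hdeg) := by
  unfold Graphing.emeas; infer_instance

lemma Graphing.emeas_real (G : Graphing) (d : ℕ) (hdeg : ∀ x : G.V, G.deg x ≤ d)
    (S : Set (G.V × G.V)) (hS : MeasurableSet S) :
    (G.emeas d hdeg).real S = ∫ x, ((GSec (G.E ∩ S) x).ncard : ℝ) ∂G.ν := by
  have hi : Integrable (S.indicator (1 : G.V × G.V → ℝ)) (G.emeas d hdeg) :=
    (integrable_const (1 : ℝ)).indicator hS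
  rw [← integral_indicator_one hS]
  unfold Graphing.emeas at hi ⊢
  rw [Measure.integral_compProd hi]
  congr 1
  funext x
  have : (fun y => S.indicator (1 : G.V × G.V → ℝ) (x, y)) = (Prod.mk x ⁻¹' S).indicator 1 := rfl
  rw [this, integral_indicator_one (measurable_prodMk_left hS), measureReal_def, ker_apply,
    G.fiber_count _ _ (measurable_prodMk_left hS)]
  rfl

lemma Graphing.emeas_swap (G : Graphing) (d : ℕ) (hdeg : ∀ x : G.V, G.deg x ≤ d) :
    (G.emeas d hdeg).map Prod.swap = G.emeas d hdeg := by
  classical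
  have key : ∀ A B : Set G.V, MeasurableSet A → MeasurableSet B →
      (G.emeas d hdeg).real (A ×ˢ B) = ∫ x in A, ((Set.ncard {y ∈ B | (x, y) ∈ G.E} : ℝ)) ∂G.ν := by
    intro A B hA hB
    rw [G.emeas_real d hdeg _ (hA.prod hB), ← integral_indicator hA]
    congr 1
    funext x
    by_cases hx : x ∈ A
    · simp only [GSec, Set.indicator, hx, if_true]
      congr 2
      ext y; simp [hx, and_comm]
    · simp [GSec, hx]
  refine Measure.ext_prod fun {A B} hA hB => ?_
  rw [Measure.map_apply measurable_swap (hA.prod hB), Set.preimage_swap_prod,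
    ← measureReal_eq_measureReal_iff, key _ _ hB hA, key _ _ hA hB]
  exact G.massTransport B A hB hA

theorem circulations_vanish_of_approximate_potentials
    (d : ℕ) (G : Graphing) (hdeg : ∀ x : G.V, G.deg x ≤ d)
    (h : ∀ O : Set (G.V × G.V), G.IsOrientation O → ∀ ε : ℝ, 0 < ε →
      ∃ g : G.V → ℝ, Measurable g ∧ (∃ C : ℝ, ∀ x : G.V, |g x| ≤ C) ∧
        (∀ x y : G.V, (x, y) ∈ G.E → g x - g y ∈ ({-1, 0, 1} : Set ℝ)) ∧
        (1 / 2 : ℝ) * ∫ x : G.V, ((Set.ncard {y : G.V | (x, y) ∈ G.E ∧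
            (((x, y) ∈ O ∧ g y ≠ g x + 1) ∨ ((y, x) ∈ O ∧ g x ≠ g y + 1))} : ℝ)) ∂G.ν
          ≤ ε)
    (f : G.V × G.V → ℝ) (hf : G.IsCirculation f)
    (hL1 : MeasureTheory.Integrable (fun x : G.V => ∑ᶠ y : G.V, |f (x, y)|) G.ν) :
    ∫ x : G.V, (∑ᶠ y : G.V, |f (x, y)|) ∂G.ν = 0 := by
  obtain ⟨hfm, hanti, hsupp, hcirc⟩ := hf
  set M := G.emeas d hdeg with hM
  have habs : ∀ x, ∫ y, |f (x, y)| ∂(G.ker d hdeg x) = ∑ᶠ y, |f (x, y)| := fun x =>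
    G.ker_integral d hdeg x _ fun y hy => by simp [hsupp x y hy]
  have hfi : Integrable f M := by
    rw [hM, Graphing.emeas, Measure.integrable_compProd_iff hfm.aestronglyMeasurable]
    refine ⟨Filter.Eventually.of_forall fun x => G.ker_integrable d hdeg x _, ?_⟩
    simpa only [Real.norm_eq_abs, habs] using hL1
  have hI : ∫ x : G.V, (∑ᶠ y : G.V, |f (x, y)|) ∂G.ν = ∫ z, |f z| ∂M := by
    have := Measure.integral_compProd (μ := G.ν) (κ := G.ker d hdeg) hfi.abs
    simp only [habs] at this
    exact this.symm
  -- the orientation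
  let e : G.V → ℝ := embeddingReal G.V
  have he : MeasurableEmbedding e := measurableEmbedding_embeddingReal G.V
  have hem := he.measurable
  let O : Set (G.V × G.V) := G.E ∩ {z | 0 < f z ∨ (f z = 0 ∧ e z.1 < e z.2)}
  have hOm : MeasurableSet O := by
    have h1 : MeasurableSet {z : G.V × G.V | e z.1 < e z.2} :=
      measurableSet_lt (by fun_prop) (by fun_prop)
    exact G.E_meas.inter ((measurableSet_lt measurable_const hfm).union
      ((measurableSet_eq_fun hfm measurable_const).inter
        h1))
  have hO : G.IsOrientation O := by
    refine ⟨Set.inter_subset_left, hOm, fun x y hxy => ?_⟩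
    have h1 := hanti x y
    have h2 := G.symm x y hxy
    have h3 : e x ≠ e y := fun hc => G.irrefl x (by
      have := he.injective hc
      rwa [← this] at hxy)
    simp only [O, Set.mem_inter_iff, Set.mem_ofPred_eq, hxy, h2, true_and, h1]
    constructor
    · rintro (hp | ⟨hp, hq⟩) (hr | ⟨hr, hs⟩) <;> linarith
    · intro hn
      push Not at hn
      obtain ⟨ha, hb⟩ := hn
      rcases ha.lt_or_eq with hlt | heq
      · left; linarith
      · right
        exact ⟨by linarith, lt_of_le_of_ne (hb heq) h3⟩
  have hOf : ∀ z ∈ O, 0 ≤ f z := by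
    rintro z ⟨_, hz | hz⟩
    · exact hz.le
    · exact hz.1.ge
  choose g hgm hgb hgE hgS using fun n : ℕ => h O hO (1 / ((n : ℝ) + 1)) (by positivity)
  let S : ℕ → Set (G.V × G.V) := fun n => {z | (z ∈ O ∧ g n z.2 ≠ g n z.1 + 1) ∨
    (z.swap ∈ O ∧ g n z.1 ≠ g n z.2 + 1)}
  have hSm : ∀ n, MeasurableSet (S n) := by
    intro n
    have := hgm n
    refine (hOm.inter (measurableSet_eq_fun ?_ ?_).compl).union
      ((measurable_swap hOm).inter (measurableSet_eq_fun ?_ ?_).compl) <;> fun_prop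
  have hSreal : ∀ n, M.real (S n) ≤ 2 * (1 / ((n : ℝ) + 1)) := by
    intro n
    have h1 := hgS n
    have h2 := G.emeas_real d hdeg (S n) (hSm n)
    have h3 : ∫ x, ((GSec (G.E ∩ S n) x).ncard : ℝ) ∂G.ν = ∫ x : G.V, ((Set.ncard {y : G.V | (x, y) ∈ G.E ∧
            (((x, y) ∈ O ∧ g n y ≠ g n x + 1) ∨ ((y, x) ∈ O ∧ g n x ≠ g n y + 1))} : ℝ)) ∂G.ν := rfl
    rw [hM, h2, h3]
    linarith
  have hStend : Filter.Tendsto (M ∘ S) Filter.atTop (nhds 0) := by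
    have hr : Filter.Tendsto (fun n => M.real (S n)) Filter.atTop (nhds 0) := by
      refine squeeze_zero (fun n => measureReal_nonneg) hSreal ?_
      simpa using (tendsto_one_div_add_atTop_nhds_zero_nat (𝕜 := ℝ)).const_mul 2
    have := ENNReal.tendsto_ofReal hr
    simpa [Function.comp_def, measureReal_def] using this
  have htend : Filter.Tendsto (fun n => ∫ z in S n, |f z| ∂M) Filter.atTop (nhds 0) :=
    hfi.abs.tendsto_setIntegral_nhds_zero hStend
  have hmain : ∀ n, ∫ z, |f z| ∂M ≤ 2 * ∫ z in S n, |f z| ∂M := by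
    intro n
    obtain ⟨C, hC⟩ := hgb n
    have hm := hgm n
    have i1 : Integrable (fun z => f z * g n z.1) M :=
      hfi.mul_bdd (c := C) (hm.comp measurable_fst).aestronglyMeasurable
        (Filter.Eventually.of_forall fun z => hC z.1)
    have i2 : Integrable (fun z => f z * g n z.2) M :=
      hfi.mul_bdd (c := C) (hm.comp measurable_snd).aestronglyMeasurable
        (Filter.Eventually.of_forall fun z => hC z.2)
    have e1 : ∫ z, f z * g n z.1 ∂M = 0 := by
      have := Measure.integral_compProd (μ := G.ν) (κ := G.ker d hdeg) i1
      rw [hM, Graphing.emeas, this]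
      simp only [integral_mul_const, G.ker_integral d hdeg _ _ (hsupp _), hcirc, zero_mul,
        integral_zero]
    have e2 : ∫ z, f z * g n z.2 ∂M = 0 := by
      have hs := G.emeas_swap d hdeg
      rw [← hM] at hs
      rw [← hs, integral_map measurable_swap.aemeasurable (by fun_prop)]
      have : (fun z : G.V × G.V => f z.swap * g n z.swap.2) = fun z => -(f z * g n z.1) := by
        funext z
        rw [show f z.swap = - f z from hanti z.2 z.1]
        simp
      rw [this, integral_neg, e1, neg_zero]
    have i3 : Integrable ((S n).indicator fun z => |f z|) M := hfi.abs.indicator (hSm n)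
    have hle : ∫ z, (|f z| - 2 * (S n).indicator (fun z => |f z|) z) ∂M
        ≤ ∫ z, (f z * g n z.2 - f z * g n z.1) ∂M := by
      refine integral_mono (hfi.abs.sub (i3.const_mul 2)) (i2.sub i1) fun z => ?_
      obtain ⟨x, y⟩ := z
      show |f (x, y)| - 2 * (S n).indicator (fun z => |f z|) (x, y)
        ≤ f (x, y) * g n y - f (x, y) * g n x
      by_cases hE : (x, y) ∈ G.E
      · by_cases hz : (x, y) ∈ S n
        · rw [Set.indicator_of_mem hz]
          have := hgE n x y hE
          have hb : |g n y - g n x| ≤ 1 := by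
            simp only [Set.mem_insert_iff, Set.mem_singleton_iff] at this
            rw [abs_le]
            rcases this with h | h | h <;> constructor <;> linarith
          have h2 : |f (x, y) * (g n y - g n x)| ≤ |f (x, y)| := by
            rw [abs_mul]
            exact mul_le_of_le_one_right (abs_nonneg _) hb
          have := (abs_le.mp h2).1
          linarith
        · rw [Set.indicator_of_notMem hz]
          simp only [S, Set.mem_ofPred_eq, not_or, not_and, not_not, Prod.swap_prod_mk] at hz
          by_cases hxy : (x, y) ∈ O
          · rw [hz.1 hxy, abs_of_nonneg (hOf _ hxy)]
            linarith
          · have hyx : (y, x) ∈ O := by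
              by_contra hc
              exact hxy ((hO.2.2 x y hE).2 hc)
            have := hOf _ hyx
            have h1 := hanti x y
            rw [hz.2 hyx, abs_of_nonpos (by linarith)]
            linarith
      · have h0 := hsupp x y hE
        have : (S n).indicator (fun z => |f z|) (x, y) = 0 := by
          simp [Set.indicator, h0]
        rw [this, h0]; simp
    rw [integral_sub i2 i1, e1, e2, integral_sub hfi.abs (i3.const_mul 2), integral_const_mul,
      integral_indicator (hSm n)] at hle
    linarith
  rw [hI]
  refine le_antisymm ?_ (integral_nonneg fun z => abs_nonneg _)
  refine ge_of_tendsto' (x := Filter.atTop) ?_ hmain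
  simpa using htend.const_mul 2
end
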